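/- Let p₁, …, p_n be polynomial differential operators with constant coefficients in ∂/∂z₁, …, ∂/∂z_n, let D u = Σ_{j=1}^n p_j(u) dz_j on A²(ℂⁿ, e^{-|z|²}) and D* its adjoint, with D* of a (1,0)-form v given by D*v = Σ_j p_j^* v_j where p_j^* is multiplication by the polynomial p_j with complex conjugate coefficients. Suppose there exists a constant C > 0 such that ‖u‖² ≤ C Σ_{j,k=1}^n ([p_k, p_j^*] u_j, u_k) for all (1,0)-forms u = Σ_j u_j dz_j ∈ dom(D) ∩ dom(D*), where [p_k, p_j^*] = p_k ∘ p_j^* − p_j^* ∘ p_k. Then ‖u‖² ≤ C(‖Du‖² + ‖D*u‖²) for all such u. -/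

import Mathlib

open MeasureTheory Filter Complex Finset

noncomputable section

/-- Points of `ℂⁿ`. -/
abbrev Cn (n : ℕ) := Fin n → ℂ

/-- A form with coefficients indexed by subsets of `{1,…,n}`; a `(p,0)`-form
`Σ'_{|J|=p} u_J dz_J` is such a family supported on sets of cardinality `p`. -/
abbrev FormC (n : ℕ) := Finset (Fin n) → Cn n → ℂ

/-- The Fock weight `e^{-|z|²}` on `ℂⁿ`. -/
def fWt {n : ℕ} (z : Cn n) : ℝ := Real.exp (-(∑ j, ‖z j‖ ^ 2))

/-- Squared Fock norm `‖f‖² = ∫ |f|² e^{-|z|²} dλ`. -/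
def fNormSq {n : ℕ} (f : Cn n → ℂ) : ℝ := ∫ z : Cn n, ‖f z‖ ^ 2 * fWt z

/-- Fock inner product `(f,g) = ∫ f ḡ e^{-|z|²} dλ`. -/
def fInner {n : ℕ} (f g : Cn n → ℂ) : ℂ :=
  ∫ z : Cn n, f z * (starRingEnd ℂ) (g z) * fWt z

/-- Membership in the Fock space `A²(ℂⁿ, e^{-|z|²})`. -/
def MemF {n : ℕ} (f : Cn n → ℂ) : Prop :=
  Differentiable ℂ f ∧ Integrable (fun z : Cn n => ‖f z‖ ^ 2 * fWt z)

/-- The holomorphic partial derivative `∂f/∂z_j`. -/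
def pdz {n : ℕ} (j : Fin n) (f : Cn n → ℂ) : Cn n → ℂ :=
  fun z => fderiv ℂ f z (Pi.single j 1)

/-- The sign `(-1)^{#{i ∈ J : i < j}}` arising from `dz_j ∧ dz_J`. -/
def sgn {n : ℕ} (j : Fin n) (J : Finset (Fin n)) : ℂ :=
  (-1 : ℂ) ^ (J.filter (fun i => i < j)).card

/-- The operator `∂`: `(∂u)_L = Σ_{j ∈ L} ± ∂u_{L\{j}}/∂z_j`, i.e.
`∂u = Σ'_J Σ_j (∂u_J/∂z_j) dz_j ∧ dz_J`. -/
def dOp {n : ℕ} (u : FormC n) : FormC n :=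
  fun L z => ∑ j ∈ L, sgn j (L.erase j) * pdz j (u (L.erase j)) z

/-- The adjoint `∂*`: `(∂*u)_K = Σ_{j ∉ K} ± z_j u_{K ∪ {j}}`, i.e.
`∂*u = Σ'_K Σ_j z_j u_{jK} dz_K` on the Fock space. -/
def dStarOp {n : ℕ} (u : FormC n) : FormC n :=
  fun K z => ∑ j ∈ Kᶜ, sgn j K * (z j * u (insert j K) z)

/-- The complex Laplacian `□̃ = ∂*∂ + ∂∂*`. -/
def boxOp {n : ℕ} (u : FormC n) : FormC n :=
  fun J z => dStarOp (dOp u) J z + dOp (dStarOp u) J z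

/-- All coefficients belong to the Fock space. -/
def MemA2 {n : ℕ} (u : FormC n) : Prop := ∀ J, MemF (u J)

/-- `u` is a `(p,0)`-form: only coefficients with `|J| = p` may be nonzero. -/
def IsDeg {n : ℕ} (p : ℕ) (u : FormC n) : Prop :=
  ∀ J : Finset (Fin n), J.card ≠ p → u J = 0

/-- Squared norm of a form: `Σ'_J ‖u_J‖²`. -/
def formNormSq {n : ℕ} (u : FormC n) : ℝ := ∑ J : Finset (Fin n), fNormSq (u J)

/-- Inner product of forms: `Σ'_J (u_J, v_J)`. -/
def formInner {n : ℕ} (u v : FormC n) : ℂ := ∑ J : Finset (Fin n), fInner (u J) (v J)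

/-- `u ∈ dom ∂`. -/
def domD {n : ℕ} (u : FormC n) : Prop := MemA2 u ∧ MemA2 (dOp u)

/-- `u ∈ dom ∂*`. -/
def domDs {n : ℕ} (u : FormC n) : Prop := MemA2 u ∧ MemA2 (dStarOp u)

/-- `u ∈ dom □̃`: `u ∈ dom ∂ ∩ dom ∂*`, `∂u ∈ dom ∂*` and `∂*u ∈ dom ∂`. -/
def domBox {n : ℕ} (u : FormC n) : Prop :=
  domD u ∧ domDs u ∧ domDs (dOp u) ∧ domD (dStarOp u)

/-- Iterated holomorphic partial derivative `(∂/∂z_j)^k`. -/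
def pdzPow {n : ℕ} (j : Fin n) : ℕ → (Cn n → ℂ) → Cn n → ℂ
  | 0, f => f
  | k + 1, f => pdz j (pdzPow j k f)

/-- The monomial differential operator `∂^m = Π_j (∂/∂z_j)^{m_j}`. -/
def applyMono {n : ℕ} (m : Fin n →₀ ℕ) (f : Cn n → ℂ) : Cn n → ℂ :=
  (List.finRange n).foldr (fun j g => pdzPow j (m j) g) f

/-- The constant-coefficient polynomial differential operator
`P(∂/∂z₁, …, ∂/∂z_n)`. -/
def polyD {n : ℕ} (P : MvPolynomial (Fin n) ℂ) (f : Cn n → ℂ) : Cn n → ℂ :=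
  fun z => ∑ m ∈ P.support, MvPolynomial.coeff m P * applyMono m f z

/-- Multiplication by `P*(z)`, where `P*` is the polynomial `P` with complex
conjugate coefficients. -/
def pMul {n : ℕ} (P : MvPolynomial (Fin n) ℂ) (f : Cn n → ℂ) : Cn n → ℂ :=
  fun z => MvPolynomial.eval z (MvPolynomial.map (starRingEnd ℂ) P) * f z

/-- The commutator `[p_k, p_j^*] = p_k ∘ p_j^* − p_j^* ∘ p_k`. -/
def commD {n : ℕ} (P Q : MvPolynomial (Fin n) ℂ) (f : Cn n → ℂ) : Cn n → ℂ :=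
  fun z => polyD P (pMul Q f) z - pMul Q (polyD P f) z

section Holomorphy

variable {n : ℕ}

lemma hasDerivAt_line {f : Cn n → ℂ} (hf : Differentiable ℂ f) (z v : Cn n) (ζ : ℂ) :
    HasDerivAt (fun ζ : ℂ => f (z + ζ • v)) (fderiv ℂ f (z + ζ • v) v) ζ := by
  have h : HasDerivAt (fun ζ : ℂ => z + ζ • v) v ζ := by
    simpa using ((hasDerivAt_id ζ).smul_const v).const_add z
  exact (hf (z + ζ • v)).hasFDerivAt.comp_hasDerivAt ζ h

/-- Cauchy's estimate along complex lines, for the full derivative. -/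
lemma norm_fderiv_le_of_bound {f : Cn n → ℂ} (hf : Differentiable ℂ f) {z : Cn n} {M : ℝ}
    (hM : ∀ w, ‖w - z‖ ≤ 1 → ‖f w‖ ≤ M) : ‖fderiv ℂ f z‖ ≤ M := by
  have hM0 : 0 ≤ M := (norm_nonneg _).trans (hM z (by simp))
  refine ContinuousLinearMap.opNorm_le_of_unit_norm hM0 fun v hv => ?_
  have hd : Differentiable ℂ (fun ζ : ℂ => f (z + ζ • v)) :=
    fun ζ => (hasDerivAt_line hf z v ζ).differentiableAt
  have := norm_deriv_le_of_forall_mem_sphere_norm_le (c := 0) (R := 1) (C := M) one_pos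
    hd.diffContOnCl (fun ζ hζ => hM _ ?_)
  · rw [(hasDerivAt_line hf z v 0).deriv] at this
    simpa using this
  · have : ‖ζ‖ = 1 := by simpa using hζ
    simp [norm_smul, this, hv]

lemma pdz_eq_circleIntegral {f : Cn n → ℂ} (hf : Differentiable ℂ f) (l : Fin n) (z : Cn n) :
    pdz l f z = (2 * Real.pi * I : ℂ)⁻¹ * ∫ θ in (0 : ℝ)..2 * Real.pi,
      (circleMap 0 1 θ * I * (1 / circleMap 0 1 θ ^ 2)) *
        f (z + circleMap 0 1 θ • Pi.single l 1) := by
  have hd : Differentiable ℂ (fun ζ : ℂ => f (z + ζ • Pi.single l 1)) :=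
    fun ζ => (hasDerivAt_line hf z _ ζ).differentiableAt
  have := (hd.differentiableOn (s := Metric.closedBall 0 1)).deriv_eq_smul_circleIntegral one_pos
  rw [(hasDerivAt_line hf z _ 0).deriv, circleIntegral] at this
  simp only [deriv_circleMap, sub_zero, smul_eq_mul, zero_smul, add_zero] at this
  rw [eq_inv_mul_iff_mul_eq₀ Complex.two_pi_I_ne_zero, pdz, ← this]
  simp only [mul_assoc]

lemma differentiable_pdz {f : Cn n → ℂ} (hf : Differentiable ℂ f) (l : Fin n) :
    Differentiable ℂ (pdz l f) := by
  intro z₀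
  rw [funext (pdz_eq_circleIntegral hf l)]
  refine DifferentiableAt.const_mul ?_ _
  obtain ⟨M, hM⟩ := (isCompact_closedBall z₀ 3).exists_bound_of_continuousOn hf.continuous.continuousOn
  have hcirc : Continuous (circleMap 0 1) := continuous_circleMap 0 1
  have hne : ∀ θ, circleMap 0 1 θ ≠ 0 := fun θ => circleMap_ne_center one_ne_zero
  have hc : Continuous fun θ : ℝ => circleMap 0 1 θ * I * (1 / circleMap 0 1 θ ^ 2) :=
    (hcirc.mul continuous_const).mul
      (continuous_const.div (hcirc.pow 2) fun θ => pow_ne_zero 2 (hne θ))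
  have hn : ∀ θ, ‖circleMap 0 1 θ‖ = 1 := by simp
  have hcn : ∀ θ : ℝ, ‖circleMap 0 1 θ * I * (1 / circleMap 0 1 θ ^ 2)‖ = 1 := by
    intro θ; simp
  have hs : ∀ x : Cn n, Continuous fun θ : ℝ => x + circleMap 0 1 θ • (Pi.single l 1 : Cn n) :=
    fun x => continuous_const.add (hcirc.smul continuous_const)
  have key := intervalIntegral.hasFDerivAt_integral_of_dominated_of_fderiv_le (𝕜 := ℂ)
    (μ := volume) (a := 0) (b := 2 * Real.pi) (bound := fun _ => M)
    (F := fun x θ => (circleMap 0 1 θ * I * (1 / circleMap 0 1 θ ^ 2)) *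
        f (x + circleMap 0 1 θ • Pi.single l 1))
    (F' := fun x θ => (circleMap 0 1 θ * I * (1 / circleMap 0 1 θ ^ 2)) •
        fderiv ℂ f (x + circleMap 0 1 θ • Pi.single l 1)) (x₀ := z₀)
    (Metric.ball_mem_nhds z₀ one_pos) ?_ ?_ ?_ ?_ ?_ ?_
  · exact key.differentiableAt
  · exact Eventually.of_forall fun x =>
      (hc.mul (hf.continuous.comp (hs x))).aestronglyMeasurable
  · exact (hc.mul (hf.continuous.comp (hs z₀))).intervalIntegrable _ _
  · exact (hc.measurable.smul ((measurable_fderiv ℂ f).comp (hs z₀).measurable)).aestronglyMeasurable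
  · refine Eventually.of_forall fun θ _ x hx => ?_
    rw [norm_smul, hcn, one_mul]
    refine norm_fderiv_le_of_bound hf fun w hw => hM w ?_
    rw [Metric.mem_ball, dist_eq_norm] at hx
    rw [Metric.mem_closedBall, dist_eq_norm]
    have h1 : ‖circleMap 0 1 θ • (Pi.single l 1 : Cn n)‖ ≤ 1 := by
      rw [norm_smul, hn, one_mul, Pi.norm_single]; simp
    calc ‖w - z₀‖ = ‖(w - (x + circleMap 0 1 θ • (Pi.single l 1 : Cn n))) + (x - z₀)
          + circleMap 0 1 θ • (Pi.single l 1 : Cn n)‖ := by congr 1; abel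
      _ ≤ 1 + 1 + 1 := norm_add₃_le.trans (add_le_add_three hw hx.le h1)
      _ = 3 := by norm_num
  · exact intervalIntegrable_const
  · refine Eventually.of_forall fun θ _ x _ => ?_
    exact ((hf _).hasFDerivAt.comp x ((hasFDerivAt_id x).add_const _)).const_mul _

lemma fderiv_eq_sum_pdz (f : Cn n → ℂ) (z : Cn n) :
    fderiv ℂ f z = ∑ l, pdz l f z • ContinuousLinearMap.proj (R := ℂ) (φ := fun _ : Fin n => ℂ) l := by
  ext v
  simp only [_root_.sum_apply, _root_.smul_apply,
    ContinuousLinearMap.proj_apply, pdz, smul_eq_mul]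
  conv_lhs => rw [← Finset.univ_sum_single v, map_sum]
  refine Finset.sum_congr rfl fun l _ => ?_
  have : (Pi.single l (v l) : Cn n) = v l • Pi.single l 1 := by
    rw [← Pi.single_smul]; simp
  rw [this, map_smul, smul_eq_mul, mul_comm]

lemma pdz_comm {f : Cn n → ℂ} (hf : Differentiable ℂ f) (l k : Fin n) :
    pdz l (pdz k f) = pdz k (pdz l f) := by
  have hd : Differentiable ℂ (fderiv ℂ f) := by
    rw [funext (fderiv_eq_sum_pdz f)]
    exact Differentiable.fun_sum fun i _ => (differentiable_pdz hf i).smul_const _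
  funext z
  have h : ∀ a b, pdz a (pdz b f) z = fderiv ℂ (fderiv ℂ f) z (Pi.single a 1) (Pi.single b 1) := by
    intro a b
    have : HasFDerivAt (pdz b f) ((fderiv ℂ (fderiv ℂ f) z).flip (Pi.single b 1)) z := by
      refine ((hd z).hasFDerivAt.clm_apply
        (hasFDerivAt_const (Pi.single b 1 : Cn n) z)).congr_fderiv ?_
      ext; simp
    rw [pdz, this.fderiv]; rfl
  rw [h, h]
  exact second_derivative_symmetric (𝕜 := ℂ) (f' := fderiv ℂ f) (fun y => (hf y).hasFDerivAt)
    (hd z).hasFDerivAt _ _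

end Holomorphy

section GaussianWeights

variable {n : ℕ}

/-- The Gaussian weight `e^{-s|z|²}`. -/
def gaussWt (s : ℝ) (z : Cn n) : ℝ := Real.exp (-(s * ∑ j, ‖z j‖ ^ 2))

lemma gaussWt_pos (s : ℝ) (z : Cn n) : 0 < gaussWt s z := Real.exp_pos _

lemma gaussWt_one : gaussWt (n := n) 1 = fWt := by
  funext z; simp [gaussWt, fWt]

lemma gaussWt_anti {s s' : ℝ} (h : s' ≤ s) (z : Cn n) : gaussWt s z ≤ gaussWt s' z := by
  have : 0 ≤ ∑ j, ‖z j‖ ^ 2 := Finset.sum_nonneg fun _ _ => by positivity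
  exact Real.exp_le_exp.2 (neg_le_neg (mul_le_mul_of_nonneg_right h this))

lemma continuous_gaussWt (s : ℝ) : Continuous (gaussWt (n := n) s) := by
  unfold gaussWt; fun_prop

lemma normSq_mul_gaussWt_le {s s' : ℝ} (h : s' < s) (l : Fin n) (z : Cn n) :
    ‖z l‖ ^ 2 * gaussWt s z ≤ (s - s')⁻¹ * gaussWt s' z := by
  have hpos : 0 < s - s' := sub_pos.2 h
  have h1 : ‖z l‖ ^ 2 ≤ ∑ j, ‖z j‖ ^ 2 :=
    Finset.single_le_sum (f := fun j => ‖z j‖ ^ 2) (fun _ _ => by positivity) (Finset.mem_univ l)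
  set A := ∑ j, ‖z j‖ ^ 2 with hA
  have h2 : gaussWt s' z = Real.exp ((s - s') * A) * gaussWt s z := by
    rw [gaussWt, gaussWt, ← hA, ← Real.exp_add]; congr 1; ring
  have h3 : (s - s') * A ≤ Real.exp ((s - s') * A) := by
    linarith [Real.add_one_le_exp ((s - s') * A)]
  rw [h2, ← mul_assoc]
  refine mul_le_mul_of_nonneg_right ?_ (gaussWt_pos s z).le
  rw [inv_mul_eq_div, le_div_iff₀ hpos, mul_comm]
  exact (mul_le_mul_of_nonneg_left h1 hpos.le).trans h3

lemma gaussWt_le_translate {s s' : ℝ} (h0 : 0 < s') (h : s' < s) :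
    ∃ K : ℝ, 0 ≤ K ∧ ∀ (z v : Cn n), ∑ j, ‖v j‖ ^ 2 ≤ 1 →
      gaussWt s z ≤ K * gaussWt s' (z + v) := by
  set η := (s - s') / s' with hη
  have hη0 : 0 < η := div_pos (sub_pos.2 h) h0
  refine ⟨Real.exp (s' * (1 + η⁻¹)), (Real.exp_pos _).le, fun z v hv => ?_⟩
  rw [gaussWt, gaussWt, ← Real.exp_add]
  refine Real.exp_le_exp.2 ?_
  have h1 : ∀ j, ‖(z + v) j‖ ^ 2 ≤ (1 + η) * ‖z j‖ ^ 2 + (1 + η⁻¹) * ‖v j‖ ^ 2 := by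
    intro j
    have h2 : ‖(z + v) j‖ ≤ ‖z j‖ + ‖v j‖ := norm_add_le _ _
    have h3 : 0 ≤ η⁻¹ * (η * ‖z j‖ - ‖v j‖) ^ 2 := by positivity
    have h4 : η⁻¹ * (η * ‖z j‖ - ‖v j‖) ^ 2
        = η * ‖z j‖ ^ 2 - 2 * ‖z j‖ * ‖v j‖ + η⁻¹ * ‖v j‖ ^ 2 := by field_simp; ring
    nlinarith [norm_nonneg ((z + v) j), norm_nonneg (z j), norm_nonneg (v j)]
  have h2 : ∑ j, ‖(z + v) j‖ ^ 2 ≤ (1 + η) * ∑ j, ‖z j‖ ^ 2 + (1 + η⁻¹) := by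
    calc _ ≤ ∑ j, ((1 + η) * ‖z j‖ ^ 2 + (1 + η⁻¹) * ‖v j‖ ^ 2) := Finset.sum_le_sum fun j _ => h1 j
      _ = (1 + η) * ∑ j, ‖z j‖ ^ 2 + (1 + η⁻¹) * ∑ j, ‖v j‖ ^ 2 := by
        rw [Finset.sum_add_distrib, Finset.mul_sum, Finset.mul_sum]
      _ ≤ _ := by
        have : 0 ≤ 1 + η⁻¹ := by positivity
        nlinarith
  have h3 : s' * (1 + η) = s := by rw [hη]; field_simp; ring
  have h4 := mul_le_mul_of_nonneg_left h2 h0.le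
  rw [mul_add, ← mul_assoc, h3] at h4
  linarith

/-- The mean value inequality for the square of a holomorphic derivative. -/
lemma normSq_pdz_le {f : Cn n → ℂ} (hf : Differentiable ℂ f) (l : Fin n) (z : Cn n) :
    ‖pdz l f z‖ ^ 2 ≤ (2 * Real.pi)⁻¹ * ∫ θ in Set.Ioc 0 (2 * Real.pi),
      ‖f (z + circleMap 0 1 θ • Pi.single l 1)‖ ^ 2 := by
  have hpi : 0 < 2 * Real.pi := Real.two_pi_pos
  set g : ℝ → ℝ := fun θ => ‖f (z + circleMap 0 1 θ • Pi.single l 1)‖ with hg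
  have hgc : Continuous g := by
    have hcirc : Continuous (circleMap 0 1) := continuous_circleMap 0 1
    exact (hf.continuous.comp (continuous_const.add (hcirc.smul continuous_const))).norm
  set c := ‖pdz l f z‖ with hc
  have h1 : 2 * Real.pi * c ≤ ∫ θ in (0 : ℝ)..2 * Real.pi, g θ := by
    rw [hc, pdz_eq_circleIntegral hf, norm_mul]
    have hn : ‖(2 * Real.pi * I : ℂ)⁻¹‖ = (2 * Real.pi)⁻¹ := by
      simp [abs_of_pos Real.pi_pos]
    rw [hn, ← mul_assoc, mul_inv_cancel₀ hpi.ne', one_mul]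
    refine (intervalIntegral.norm_integral_le_integral_norm hpi.le).trans (le_of_eq ?_)
    refine intervalIntegral.integral_congr fun θ _ => ?_
    simp [hg]
  have h2 : 2 * c * ∫ θ in (0 : ℝ)..2 * Real.pi, g θ ≤
      ∫ θ in (0 : ℝ)..2 * Real.pi, (c ^ 2 + g θ ^ 2) := by
    rw [← intervalIntegral.integral_const_mul]
    refine intervalIntegral.integral_mono_on hpi.le
      ((hgc.const_mul _).intervalIntegrable _ _)
      ((continuous_const.add (hgc.pow 2)).intervalIntegrable _ _) fun θ _ => ?_
    nlinarith [sq_nonneg (c - g θ)]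
  rw [intervalIntegral.integral_add intervalIntegrable_const
    (Continuous.intervalIntegrable (u := fun θ => g θ ^ 2) (hgc.pow 2) _ _), intervalIntegral.integral_const, sub_zero,
    smul_eq_mul, intervalIntegral.integral_of_le hpi.le (f := fun θ => g θ ^ 2)] at h2
  have hc0 : 0 ≤ c := norm_nonneg _
  rw [inv_mul_eq_div, le_div_iff₀ hpi]
  nlinarith

lemma integrable_normSq_pdz {f : Cn n → ℂ} (hf : Differentiable ℂ f) (l : Fin n) {s s' : ℝ}
    (h0 : 0 < s') (h : s' < s) (hi : Integrable fun z => ‖f z‖ ^ 2 * gaussWt s' z) :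
    Integrable fun z => ‖pdz l f z‖ ^ 2 * gaussWt s z := by
  obtain ⟨K, hK0, hK⟩ := gaussWt_le_translate (n := n) h0 h
  set φ : Cn n → ℝ := fun z => ‖f z‖ ^ 2 * gaussWt s' z with hφ
  have hφc : Continuous φ := (hf.continuous.norm.pow 2).mul (continuous_gaussWt s')
  have hcirc : Continuous (circleMap 0 1) := continuous_circleMap 0 1
  have hsh : Continuous fun p : Cn n × ℝ => p.1 + circleMap 0 1 p.2 • (Pi.single l 1 : Cn n) :=
    continuous_fst.add ((hcirc.comp continuous_snd).smul continuous_const)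
  set μ : Measure ℝ := volume.restrict (Set.Ioc 0 (2 * Real.pi)) with hμ
  have hprod : Integrable (fun p : Cn n × ℝ => φ (p.1 + circleMap 0 1 p.2 • Pi.single l 1))
      (volume.prod μ) := by
    refine (integrable_prod_iff' (hφc.comp hsh).aestronglyMeasurable).2
      ⟨Eventually.of_forall fun θ => ?_, ?_⟩
    · exact Integrable.comp_add_right (f := φ) hi (circleMap 0 1 θ • Pi.single l 1)
    refine (integrable_const (μ := μ) (∫ z, ‖φ z‖)).congr (Eventually.of_forall fun θ => ?_)
    exact (integral_add_right_eq_self (fun z => ‖φ z‖) (circleMap 0 1 θ • Pi.single l 1)).symm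
  have hintegrable := hprod.integral_prod_left.const_mul ((2 * Real.pi)⁻¹ * K)
  refine hintegrable.mono' (((differentiable_pdz hf l).continuous.norm.pow 2).mul
    (continuous_gaussWt s)).aestronglyMeasurable (Eventually.of_forall fun z => ?_)
  rw [Real.norm_of_nonneg (mul_nonneg (by positivity) (gaussWt_pos _ _).le)]
  have hzc : Continuous fun θ : ℝ => z + circleMap 0 1 θ • (Pi.single l 1 : Cn n) :=
    continuous_const.add (hcirc.smul continuous_const)
  calc ‖pdz l f z‖ ^ 2 * gaussWt s z
      ≤ ((2 * Real.pi)⁻¹ * ∫ θ, ‖f (z + circleMap 0 1 θ • Pi.single l 1)‖ ^ 2 ∂μ) *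
          gaussWt s z := mul_le_mul_of_nonneg_right (normSq_pdz_le hf l z) (gaussWt_pos _ _).le
    _ = (2 * Real.pi)⁻¹ * ∫ θ, ‖f (z + circleMap 0 1 θ • Pi.single l 1)‖ ^ 2 * gaussWt s z ∂μ := by
        rw [integral_mul_const, mul_assoc]
    _ ≤ (2 * Real.pi)⁻¹ * ∫ θ, K * φ (z + circleMap 0 1 θ • Pi.single l 1) ∂μ := by
        refine mul_le_mul_of_nonneg_left ?_ (inv_nonneg.2 Real.two_pi_pos.le)
        refine integral_mono ?_ ?_ fun θ => ?_
        · exact (((hf.continuous.comp hzc).norm.pow 2).mul_const _).integrableOn_Ioc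
        · exact ((hφc.comp hzc).const_mul K).integrableOn_Ioc
        · have := hK z (circleMap 0 1 θ • Pi.single l 1) (by
            rw [Finset.sum_eq_single l] <;> simp +contextual)
          simp only [hφ]
          calc _ ≤ ‖f (z + circleMap 0 1 θ • Pi.single l 1)‖ ^ 2 *
                (K * gaussWt s' (z + circleMap 0 1 θ • Pi.single l 1)) :=
                mul_le_mul_of_nonneg_left this (by positivity)
            _ = _ := by ring
    _ = _ := by rw [integral_const_mul, mul_assoc]

end GaussianWeights

section EntireGrowth

variable {n : ℕ}

/-- Entire functions that are square integrable against every weight `e^{-s|z|²}` with `s > 1`. -/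
def EntireGrowth (n : ℕ) : Submodule ℂ (Cn n → ℂ) where
  carrier := {f | Differentiable ℂ f ∧
    ∀ s : ℝ, 1 < s → Integrable fun z => ‖f z‖ ^ 2 * gaussWt s z}
  zero_mem' := ⟨differentiable_const 0, fun s _ => by simp⟩
  add_mem' := by
    rintro f g ⟨hf, hf'⟩ ⟨hg, hg'⟩
    refine ⟨hf.add hg, fun s hs => ?_⟩
    refine (((hf' s hs).const_mul 2).add ((hg' s hs).const_mul 2)).mono'
      (((hf.add hg).continuous.norm.pow 2).mul (continuous_gaussWt s)).aestronglyMeasurable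
      (Eventually.of_forall fun z => ?_)
    have hw := gaussWt_pos s z
    rw [Real.norm_of_nonneg (mul_nonneg (by positivity) hw.le)]
    have h1 : ‖(f + g) z‖ ^ 2 ≤ 2 * ‖f z‖ ^ 2 + 2 * ‖g z‖ ^ 2 := by
      have := norm_add_le (f z) (g z)
      have h0 := norm_nonneg (f z + g z)
      simp only [Pi.add_apply]
      nlinarith [sq_nonneg (‖f z‖ - ‖g z‖)]
    calc _ ≤ (2 * ‖f z‖ ^ 2 + 2 * ‖g z‖ ^ 2) * gaussWt s z := mul_le_mul_of_nonneg_right h1 hw.le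
      _ = _ := by simp only [Pi.add_apply]; ring
  smul_mem' := by
    rintro c f ⟨hf, hf'⟩
    refine ⟨hf.const_smul c, fun s hs => ((hf' s hs).const_mul (‖c‖ ^ 2)).congr
      (Eventually.of_forall fun z => ?_)⟩
    simp only [Pi.smul_apply, norm_smul]; ring

lemma MemF.mem_entireGrowth {f : Cn n → ℂ} (hf : MemF f) : f ∈ EntireGrowth n := by
  refine ⟨hf.1, fun s hs => hf.2.mono'
    ((hf.1.continuous.norm.pow 2).mul (continuous_gaussWt s)).aestronglyMeasurable
    (Eventually.of_forall fun z => ?_)⟩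
  rw [Real.norm_of_nonneg (mul_nonneg (by positivity) (gaussWt_pos s z).le), ← gaussWt_one]
  exact mul_le_mul_of_nonneg_left (gaussWt_anti hs.le z) (by positivity)

namespace EntireGrowth

/-- The partial derivative `∂/∂z_l`. -/
def dz (l : Fin n) : Module.End ℂ (EntireGrowth n) where
  toFun f := ⟨pdz l f, differentiable_pdz f.2.1 l, fun s hs => by
    have h1 : 1 < (1 + s) / 2 := by linarith
    exact integrable_normSq_pdz f.2.1 l (by linarith) (by linarith : (1 + s) / 2 < s)
      (f.2.2 _ h1)⟩
  map_add' f g := by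
    ext z
    simp only [pdz, Submodule.coe_add, Pi.add_apply]
    rw [fderiv_add (f.2.1 z) (g.2.1 z)]; rfl
  map_smul' c f := by
    ext z
    simp only [pdz, Submodule.coe_smul, RingHom.id_apply, Pi.smul_apply]
    rw [fderiv_const_smul (f.2.1 z)]; rfl

lemma integrable_normSq_coord_mul (l : Fin n) (f : EntireGrowth n) {s s' : ℝ} (h1 : 1 < s')
    (h : s' < s) : Integrable (fun z => ‖z l * (f : Cn n → ℂ) z‖ ^ 2 * gaussWt s z) ∧
      ∫ z, ‖z l * (f : Cn n → ℂ) z‖ ^ 2 * gaussWt s z ≤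
        (s - s')⁻¹ * ∫ z, ‖(f : Cn n → ℂ) z‖ ^ 2 * gaussWt s' z := by
  have hle : ∀ z : Cn n, ‖z l * (f : Cn n → ℂ) z‖ ^ 2 * gaussWt s z ≤
      (s - s')⁻¹ * (‖(f : Cn n → ℂ) z‖ ^ 2 * gaussWt s' z) := by
    intro z
    have := mul_le_mul_of_nonneg_right (normSq_mul_gaussWt_le h l z)
      (sq_nonneg ‖(f : Cn n → ℂ) z‖)
    rw [norm_mul]
    calc _ = ‖z l‖ ^ 2 * gaussWt s z * ‖(f : Cn n → ℂ) z‖ ^ 2 := by ring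
      _ ≤ _ := this
      _ = _ := by ring
  have hi := (f.2.2 _ h1).const_mul (s - s')⁻¹
  have hintegrable : Integrable (fun z => ‖z l * (f : Cn n → ℂ) z‖ ^ 2 * gaussWt s z) := by
    refine hi.mono' ((((continuous_apply l).mul f.2.1.continuous).norm.pow 2).mul
      (continuous_gaussWt s)).aestronglyMeasurable (Eventually.of_forall fun z => ?_)
    rw [Real.norm_of_nonneg (mul_nonneg (by positivity) (gaussWt_pos s z).le)]
    exact hle z
  refine ⟨hintegrable, ?_⟩
  rw [← integral_const_mul]
  exact integral_mono hintegrable hi hle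

/-- Multiplication by the coordinate `z_l`. -/
def mulz (l : Fin n) : Module.End ℂ (EntireGrowth n) where
  toFun f := ⟨fun z => z l * (f : Cn n → ℂ) z, (differentiable_apply l).mul f.2.1,
    fun s hs => (integrable_normSq_coord_mul l f (by linarith : 1 < (1 + s) / 2)
      (by linarith : (1 + s) / 2 < s)).1⟩
  map_add' f g := by ext z; simp [mul_add]
  map_smul' c f := by ext z; simp; ring

lemma dz_apply (l : Fin n) (f : EntireGrowth n) : (dz l f : Cn n → ℂ) = pdz l f := rfl

lemma mulz_apply (l : Fin n) (f : EntireGrowth n) (z : Cn n) :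
    (mulz l f : Cn n → ℂ) z = z l * (f : Cn n → ℂ) z := rfl

lemma dz_comm (l k : Fin n) : dz l * dz k = dz k * dz (n := n) l := by
  ext f : 2
  exact pdz_comm f.2.1 l k

lemma mulz_comm (l k : Fin n) : mulz l * mulz k = mulz k * mulz (n := n) l := by
  ext f z
  simp only [Module.End.mul_apply, mulz_apply]; ring

lemma dz_mul_mulz (l k : Fin n) :
    dz l * mulz k = mulz k * dz (n := n) l + if l = k then 1 else 0 := by
  ext f z
  have h : HasFDerivAt (fun z => z k * (f : Cn n → ℂ) z) _ z :=
    (hasFDerivAt_apply (𝕜 := ℂ) k z).mul (f.2.1 z).hasFDerivAt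
  have h1 : ((dz l * mulz k) f : Cn n → ℂ) z = fderiv ℂ (fun z => z k * (f : Cn n → ℂ) z) z
    (Pi.single l 1) := rfl
  rw [h1, h.fderiv]
  by_cases hlk : l = k
  · subst hlk
    simp [mulz_apply, dz_apply, pdz]
  · simp [mulz_apply, dz_apply, pdz, hlk, Ne.symm hlk]

/-- The pairing `∫ f ḡ e^{-s|z|²}`. -/
def pairing (s : ℝ) (f g : EntireGrowth n) : ℂ :=
  ∫ z, (f : Cn n → ℂ) z * (starRingEnd ℂ) ((g : Cn n → ℂ) z) * gaussWt s z

lemma integrable_pairing {s : ℝ} (hs : 1 < s) (f g : EntireGrowth n) :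
    Integrable fun z => (f : Cn n → ℂ) z * (starRingEnd ℂ) ((g : Cn n → ℂ) z) * gaussWt s z := by
  refine ((f.2.2 _ hs).add (g.2.2 _ hs)).mono' ?_
    (Eventually.of_forall fun z => ?_)
  · exact ((f.2.1.continuous.mul (continuous_conj.comp g.2.1.continuous)).mul
      (continuous_ofReal.comp (continuous_gaussWt s))).aestronglyMeasurable
  · have hw := gaussWt_pos s z
    simp only [norm_mul, norm_conj, norm_real, Real.norm_of_nonneg hw.le, Pi.add_apply]
    rw [← add_mul]
    refine mul_le_mul_of_nonneg_right ?_ hw.le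
    nlinarith [sq_nonneg (‖(f : Cn n → ℂ) z‖ - ‖(g : Cn n → ℂ) z‖),
      sq_nonneg (‖(f : Cn n → ℂ) z‖), sq_nonneg (‖(g : Cn n → ℂ) z‖)]

lemma pairing_add_left {s : ℝ} (hs : 1 < s) (f f' g : EntireGrowth n) :
    pairing s (f + f') g = pairing s f g + pairing s f' g := by
  rw [pairing, pairing, pairing, ← integral_add (integrable_pairing hs f g)
    (integrable_pairing hs f' g)]
  congr 1; funext z; simp; ring

lemma pairing_smul_left (s : ℝ) (c : ℂ) (f g : EntireGrowth n) :
    pairing s (c • f) g = c * pairing s f g := by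
  rw [pairing, pairing, ← integral_const_mul]
  congr 1; funext z; simp; ring

lemma pairing_conj (s : ℝ) (f g : EntireGrowth n) :
    (starRingEnd ℂ) (pairing s f g) = pairing s g f := by
  rw [pairing, pairing, ← integral_conj]
  congr 1; funext z
  simp only [map_mul, conj_conj, conj_ofReal]; ring

lemma pairing_add_right {s : ℝ} (hs : 1 < s) (f g g' : EntireGrowth n) :
    pairing s f (g + g') = pairing s f g + pairing s f g' := by
  rw [← pairing_conj, pairing_add_left hs, map_add, pairing_conj, pairing_conj]

lemma pairing_smul_right (s : ℝ) (c : ℂ) (f g : EntireGrowth n) :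
    pairing s f (c • g) = (starRingEnd ℂ) c * pairing s f g := by
  rw [← pairing_conj, pairing_smul_left, map_mul, pairing_conj]

lemma pairing_line {s : ℝ} (hs : 1 < s) (l : Fin n) (c : ℂ) (f g : EntireGrowth n) :
    c * pairing s (dz l f) g + (starRingEnd ℂ) c * pairing s f (dz l g)
      - s * c * pairing s f (mulz l g) - s * (starRingEnd ℂ) c * pairing s (mulz l f) g = 0 := by
  set F : Cn n → ℂ := fun z =>
    (f : Cn n → ℂ) z * (starRingEnd ℂ) ((g : Cn n → ℂ) z) * gaussWt s z with hF
  set F' : Cn n → ℂ := fun z =>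
    c * ((dz l f : Cn n → ℂ) z * (starRingEnd ℂ) ((g : Cn n → ℂ) z) * gaussWt s z)
      + (starRingEnd ℂ) c *
        ((f : Cn n → ℂ) z * (starRingEnd ℂ) ((dz l g : Cn n → ℂ) z) * gaussWt s z)
      - s * c * ((f : Cn n → ℂ) z * (starRingEnd ℂ) ((mulz l g : Cn n → ℂ) z) * gaussWt s z)
      - s * (starRingEnd ℂ) c *
        ((mulz l f : Cn n → ℂ) z * (starRingEnd ℂ) ((g : Cn n → ℂ) z) * gaussWt s z) with hF'
  have i1 := (integrable_pairing hs (dz l f) g).const_mul c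
  have i2 := (integrable_pairing hs f (dz l g)).const_mul ((starRingEnd ℂ) c)
  have i3 := (integrable_pairing hs f (mulz l g)).const_mul (s * c)
  have i4 := (integrable_pairing hs (mulz l f) g).const_mul (s * (starRingEnd ℂ) c)
  have hF'i : Integrable F' := ((i1.add i2).sub i3).sub i4
  have hFi : Integrable F := integrable_pairing hs f g
  have hintegrable : ∫ z, F' z = c * pairing s (dz l f) g + (starRingEnd ℂ) c * pairing s f (dz l g)
      - s * c * pairing s f (mulz l g) - s * (starRingEnd ℂ) c * pairing s (mulz l f) g := by
    simp only [pairing, ← integral_const_mul]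
    rw [← integral_add i1 i2]
    erw [← integral_sub (i1.add i2) i3, ← integral_sub ((i1.add i2).sub i3) i4]
    rfl
  rw [← hintegrable]
  set v : Cn n := c • Pi.single l 1 with hv
  have hder : ∀ z, HasLineDerivAt ℝ F (F' z) z v := by
    intro z
    have hline : ∀ h : EntireGrowth n, HasDerivAt (fun t : ℝ => (h : Cn n → ℂ) (z + t • v))
        (c * (dz l h : Cn n → ℂ) z) 0 := by
      intro h
      have h1 := (hasDerivAt_line h.2.1 z v ((0 : ℝ) : ℂ)).comp_ofReal
      have h2 : fderiv ℂ (h : Cn n → ℂ) z v = c * (dz l h : Cn n → ℂ) z := by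
        rw [hv, map_smul]; rfl
      simpa [h2] using h1
    have hsq : HasDerivAt (fun t : ℝ => ∑ j, ‖(z + t • v) j‖ ^ 2)
        (c * (starRingEnd ℂ) (z l) + (starRingEnd ℂ) c * z l).re 0 := by
      have : ∀ t : ℝ, ∑ j, ‖(z + t • v) j‖ ^ 2 = ∑ j, ‖z j‖ ^ 2
          + t * (c * (starRingEnd ℂ) (z l) + (starRingEnd ℂ) c * z l).re + t ^ 2 * ‖c‖ ^ 2 := by
        intro t
        rw [← Finset.add_sum_erase _ _ (Finset.mem_univ l),
          ← Finset.add_sum_erase (f := fun j => ‖z j‖ ^ 2) _ (Finset.mem_univ l)]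
        have h1 : ∑ j ∈ Finset.univ.erase l, ‖(z + t • v) j‖ ^ 2
            = ∑ j ∈ Finset.univ.erase l, ‖z j‖ ^ 2 := by
          refine Finset.sum_congr rfl fun j hj => ?_
          simp [hv, Finset.ne_of_mem_erase hj]
        have h2 : ‖(z + t • v) l‖ ^ 2 = ‖z l‖ ^ 2
            + t * (c * (starRingEnd ℂ) (z l) + (starRingEnd ℂ) c * z l).re + t ^ 2 * ‖c‖ ^ 2 := by
          simp only [hv, Pi.add_apply, Pi.smul_apply, Pi.single_eq_same, Complex.sq_norm,
            Complex.normSq_apply]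
          simp
          ring
        rw [h1, h2]; ring
      rw [funext this]
      have h3 := ((hasDerivAt_id (0 : ℝ)).mul_const
        (c * (starRingEnd ℂ) (z l) + (starRingEnd ℂ) c * z l).re).const_add (∑ j, ‖z j‖ ^ 2)
      have h4 := ((hasDerivAt_id (0 : ℝ)).pow 2).mul_const (‖c‖ ^ 2)
      refine (h3.add h4).congr_deriv ?_
      simp
    have hw := ((hsq.const_mul s).neg.exp).ofReal_comp
    have := ((hline f).mul ((hline g).star)).mul hw
    refine HasDerivAt.congr_deriv (f := fun t : ℝ => F (z + t • v)) this ?_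
    have hre : (((c * (starRingEnd ℂ) (z l) + (starRingEnd ℂ) c * z l).re : ℝ) : ℂ)
        = c * (starRingEnd ℂ) (z l) + (starRingEnd ℂ) c * z l := by
      apply Complex.ext <;> simp; ring
    simp only [hF', mulz_apply, gaussWt, Pi.neg_apply, Pi.mul_apply, ofReal_mul, ofReal_neg, hre, zero_smul, add_zero, map_mul,
      star_def, ofReal_exp]
    ring
  have key := integral_bilinear_hasLineDerivAt_right_eq_neg_left_of_integrable (μ := volume)
    (f := fun _ : Cn n => (1 : ℝ)) (f' := fun _ => 0) (g := F) (g' := F') (v := v)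
    (B := ContinuousLinearMap.lsmul ℝ ℝ) (by simp) (by simpa using hF'i) (by simpa using hFi)
    (fun z _ => by simpa [HasLineDerivAt] using hasDerivAt_const (0 : ℝ) (1 : ℝ)) (fun z _ => hder z)
  simpa using key

/-- With respect to `e^{-s|z|²}`, the adjoint of `∂/∂z_l` is multiplication by `s z_l`. -/
lemma pairing_dz {s : ℝ} (hs : 1 < s) (l : Fin n) (f g : EntireGrowth n) :
    pairing s (dz l f) g = s * pairing s f (mulz l g) := by
  have h1 := pairing_line hs l 1 f g
  have h2 := pairing_line hs l I f g
  simp only [map_one, conj_I, one_mul, mul_one] at h1 h2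
  have hI : I * I = -1 := I_mul_I
  linear_combination (1 / 2) * h1 - (I / 2) * h2 + (1 / 2) * (pairing s (dz l f) g
    - pairing s f (dz l g) - s * pairing s f (mulz l g) + s * pairing s (mulz l f) g) * hI

end EntireGrowth

end EntireGrowth

namespace MvPolynomial

lemma exists_algHom_of_commute {σ R A : Type*} [CommRing R] [Ring A] [Algebra R A] (a : σ → A)
    (h : ∀ i j, a i * a j = a j * a i) : ∃ φ : MvPolynomial σ R →ₐ[R] A, ∀ i, φ (X i) = a i := by
  have := Algebra.isMulCommutative_adjoin R (s := Set.range a) (by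
    rintro _ ⟨i, rfl⟩ _ ⟨j, rfl⟩; exact h i j)
  open scoped IsMulCommutative in
  exact ⟨(Algebra.adjoin R (Set.range a)).val.comp
    (aeval fun i => ⟨a i, Algebra.subset_adjoin ⟨i, rfl⟩⟩), fun i => by simp⟩

variable {n : ℕ}

/-- The Taylor expansion `P(x + y)`, as a polynomial in `y` with coefficients polynomial in `x`. -/
def taylorExp : MvPolynomial (Fin n) ℂ →ₐ[ℂ] MvPolynomial (Fin n) (MvPolynomial (Fin n) ℂ) :=
  aeval fun l => C (X l) + X l

/-- The Taylor coefficient `∂^α P / α!`. -/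
def taylorCoeff (α : Fin n →₀ ℕ) : MvPolynomial (Fin n) ℂ →+ MvPolynomial (Fin n) ℂ :=
  (coeffAddMonoidHom α).comp (taylorExp (n := n)).toRingHom.toAddMonoidHom

/-- The nonzero multi-indices that occur in the Taylor expansion of `P`. -/
def taylorSupp (P : MvPolynomial (Fin n) ℂ) : Finset (Fin n →₀ ℕ) := (taylorExp P).support.erase 0

lemma taylorCoeff_apply (α : Fin n →₀ ℕ) (P : MvPolynomial (Fin n) ℂ) :
    taylorCoeff α P = coeff α (taylorExp P) := rfl

lemma ne_zero_of_mem_taylorSupp {P : MvPolynomial (Fin n) ℂ} {α : Fin n →₀ ℕ} (h : α ∈ taylorSupp P) :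
    α ≠ 0 := Finset.ne_of_mem_erase h

lemma taylorExp_C (a : ℂ) : taylorExp (n := n) (C a) = C (C a) := by
  simp [taylorExp, algebraMap_eq, algebraMap_apply]

lemma taylorExp_mul_X (P : MvPolynomial (Fin n) ℂ) (l : Fin n) :
    taylorExp (P * X l) = taylorExp P * (C (X l) + X l) := by
  simp [taylorExp]

lemma taylorCoeff_zero (P : MvPolynomial (Fin n) ℂ) : taylorCoeff 0 P = P := by
  induction P using MvPolynomial.induction_on with
  | C a => simp [taylorCoeff_apply]
  | add P Q hP hQ => rw [map_add, hP, hQ]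
  | mul_X P l hP =>
    rw [taylorCoeff_apply] at hP ⊢
    rw [taylorExp_mul_X, mul_add, coeff_add, coeff_mul_X', mul_comm, coeff_C_mul, hP]
    simp [mul_comm]

lemma taylorCoeff_mul_X (α : Fin n →₀ ℕ) (P : MvPolynomial (Fin n) ℂ) (l : Fin n) :
    taylorCoeff α (P * X l) = taylorCoeff α P * X l +
      if l ∈ α.support then taylorCoeff (α - Finsupp.single l 1) P else 0 := by
  simp only [taylorCoeff_apply]
  rw [taylorExp_mul_X, mul_add, coeff_add, coeff_mul_X', mul_comm, coeff_C_mul, mul_comm]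

lemma pderiv_taylorExp (l : Fin n) (P : MvPolynomial (Fin n) ℂ) :
    pderiv l (taylorExp P) = taylorExp (pderiv l P) := by
  induction P using MvPolynomial.induction_on with
  | C a => simp
  | add P Q hP hQ => simp only [map_add, hP, hQ]
  | mul_X P k hP =>
    rw [taylorExp_mul_X, pderiv_mul, pderiv_mul, hP, map_add taylorExp, taylorExp_mul_X, map_add,
      pderiv_C, zero_add]
    by_cases h : k = l
    · subst h; simp
    · simp [pderiv_X_of_ne h]

lemma pderiv_taylorCoeff_comm (l : Fin n) (P : MvPolynomial (Fin n) ℂ) :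
    ∀ α, pderiv l (taylorCoeff α P) = taylorCoeff α (pderiv l P) := by
  induction P using MvPolynomial.induction_on with
  | C a =>
    intro α
    rw [taylorCoeff_apply, taylorExp_C, pderiv_C, map_zero, coeff_C]
    split_ifs <;> simp
  | add P Q hP hQ => intro α; simp only [map_add, hP, hQ]
  | mul_X P k hP =>
    intro α
    rw [taylorCoeff_mul_X, map_add, pderiv_mul, pderiv_mul, map_add, taylorCoeff_mul_X, ← hP]
    have h1 : taylorCoeff α (P * pderiv l (X k)) = taylorCoeff α P * pderiv l (X k) := by
      by_cases h : k = l
      · subst h; simp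
      · simp [pderiv_X_of_ne h]
    rw [h1]
    split_ifs
    · rw [hP, hP (α - Finsupp.single k 1)]; ring
    · simp

lemma pderiv_taylorCoeff (l : Fin n) (α : Fin n →₀ ℕ) (P : MvPolynomial (Fin n) ℂ) :
    pderiv l (taylorCoeff α P) = (α l + 1 : ℕ) • taylorCoeff (α + Finsupp.single l 1) P := by
  rw [pderiv_taylorCoeff_comm, taylorCoeff_apply, ← pderiv_taylorExp, coeff_pderiv,
    taylorCoeff_apply, nsmul_eq_mul, mul_comm]
  push_cast; ring

/-- The factorial `α!` of a multi-index. -/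
def indexFactorial (α : Fin n →₀ ℕ) : ℕ := ∏ i, (α i).factorial

lemma indexFactorial_pos (α : Fin n →₀ ℕ) : 0 < indexFactorial α :=
  Finset.prod_pos fun i _ => (α i).factorial_pos

lemma indexFactorial_add_single (α : Fin n →₀ ℕ) (l : Fin n) :
    indexFactorial (α + Finsupp.single l 1) = indexFactorial α * (α l + 1) := by
  rw [indexFactorial, indexFactorial, ← Finset.mul_prod_erase _ _ (Finset.mem_univ l),
    ← Finset.mul_prod_erase (f := fun i => (α i).factorial) _ (Finset.mem_univ l)]
  have : ∏ x ∈ Finset.univ.erase l, ((α + Finsupp.single l 1 : Fin n →₀ ℕ) x).factorial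
      = ∏ x ∈ Finset.univ.erase l, (α x).factorial :=
    Finset.prod_congr rfl fun x hx => by
      simp [(Finset.ne_of_mem_erase hx).symm]
  rw [this]
  simp only [Finsupp.add_apply, Finsupp.single_eq_same, Nat.factorial_succ]
  ring

/-- The iterated derivative `∂^α P`. -/
def iterPDeriv (α : Fin n →₀ ℕ) : MvPolynomial (Fin n) ℂ →+ MvPolynomial (Fin n) ℂ :=
  indexFactorial α • taylorCoeff α

lemma iterPDeriv_apply (α : Fin n →₀ ℕ) (P : MvPolynomial (Fin n) ℂ) :
    iterPDeriv α P = indexFactorial α • taylorCoeff α P := rfl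

lemma iterPDeriv_zero (P : MvPolynomial (Fin n) ℂ) : iterPDeriv 0 P = P := by
  simp [iterPDeriv_apply, indexFactorial, taylorCoeff_zero]

lemma pderiv_iterPDeriv (l : Fin n) (α : Fin n →₀ ℕ) (P : MvPolynomial (Fin n) ℂ) :
    pderiv l (iterPDeriv α P) = iterPDeriv (α + Finsupp.single l 1) P := by
  rw [iterPDeriv_apply, iterPDeriv_apply, map_nsmul, pderiv_taylorCoeff, smul_smul,
    indexFactorial_add_single]

/-- A family of additive maps obeying a Leibniz rule is determined by Taylor's formula. -/
lemma taylor_expansion {V : Type*} [AddCommGroup V] (S : MvPolynomial (Fin n) ℂ →+ V)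
    (Φ : (Fin n →₀ ℕ) → MvPolynomial (Fin n) ℂ →+ V) (D : Fin n → V →+ V)
    (hC : ∀ a, S (C a) = Φ 0 (C a)) (hX : ∀ P l, S (P * X l) = D l (S P))
    (hD : ∀ l α P, D l (Φ α P) = Φ α (P * X l) + Φ (α + Finsupp.single l 1) P)
    (P : MvPolynomial (Fin n) ℂ) :
    S P = Φ 0 P + ∑ α ∈ taylorSupp P, Φ α (taylorCoeff α P) := by
  set Ψ : MvPolynomial (Fin n) (MvPolynomial (Fin n) ℂ) → V := fun T => ∑ α ∈ T.support, Φ α (coeff α T)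
    with hΨ
  have hsub : ∀ T (s : Finset (Fin n →₀ ℕ)), T.support ⊆ s → Ψ T = ∑ α ∈ s, Φ α (coeff α T) := by
    intro T s hs
    refine Finset.sum_subset hs fun α _ hα => ?_
    rw [notMem_support_iff.1 hα, map_zero]
  have hadd : ∀ T T', Ψ (T + T') = Ψ T + Ψ T' := by
    intro T T'
    rw [hsub (T + T') (T.support ∪ T'.support) support_add,
      hsub T _ Finset.subset_union_left, hsub T' _ Finset.subset_union_right,
      ← Finset.sum_add_distrib]
    exact Finset.sum_congr rfl fun α _ => by rw [coeff_add, map_add]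
  have hmono : ∀ α Q, Ψ (monomial α Q) = Φ α Q := by
    intro α Q
    rw [hsub _ {α} support_monomial_subset, Finset.sum_singleton, coeff_monomial, if_pos rfl]
  have hDΨ : ∀ l T, D l (Ψ T) = Ψ (T * (C (X l) + X l)) := by
    intro l T
    induction T using MvPolynomial.induction_on' with
    | monomial α Q =>
      have h : monomial α Q * X l = monomial (α + Finsupp.single l 1) Q := by
        rw [X, monomial_mul, mul_one]
      rw [hmono, hD, mul_add, mul_comm (monomial α Q), C_mul_monomial, hadd, hmono, h, hmono,
        mul_comm (X l)]
    | add T T' hT hT' => rw [hadd, map_add, hT, hT', add_mul, hadd]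
  have hS : S P = Ψ (taylorExp P) := by
    induction P using MvPolynomial.induction_on with
    | C a =>
      have : (C (C a) : MvPolynomial (Fin n) (MvPolynomial (Fin n) ℂ)) = monomial 0 (C a) := rfl
      rw [hC, taylorExp_C, this, hmono]
    | add P Q hP hQ => rw [map_add, map_add, hadd, hP, hQ]
    | mul_X P l hP => rw [hX, hP, hDΨ, taylorExp_mul_X]
  rw [hS, hsub _ (insert 0 (taylorSupp P))
    (by rw [taylorSupp]; exact Finset.insert_erase_subset _ _),
    Finset.sum_insert (by simp [taylorSupp])]
  rw [← taylorCoeff_apply, taylorCoeff_zero]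
  rfl

/-- The dilated polynomial `P(c x)`. -/
def dilate (c : ℂ) : MvPolynomial (Fin n) ℂ →ₐ[ℂ] MvPolynomial (Fin n) ℂ := aeval fun l => C c * X l

lemma dilate_X (c : ℂ) (l : Fin n) : dilate c (X l : MvPolynomial (Fin n) ℂ) = C c * X l := by
  simp [dilate]

lemma dilate_C (c a : ℂ) : dilate c (C a : MvPolynomial (Fin n) ℂ) = C a := by
  simp [dilate]

lemma dilate_eq (c : ℂ) (P : MvPolynomial (Fin n) ℂ) :
    dilate c P = P + ∑ β ∈ taylorSupp P,
      (c - 1) ^ β.degree • (monomial β 1 * taylorCoeff β P) := by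
  have := taylor_expansion (n := n) (dilate c).toRingHom.toAddMonoidHom
    (fun β => AddMonoidHom.mulLeft ((c - 1) ^ β.degree • monomial β 1))
    (fun l => AddMonoidHom.mulLeft (C c * X l)) ?_ ?_ ?_ P
  · simpa [smul_mul_assoc] using this
  · intro a; simp
  · intro P l
    simp [dilate_X, mul_comm]
  · intro l α P
    have h1 : (monomial (α + Finsupp.single l 1) 1 : MvPolynomial (Fin n) ℂ) = monomial α 1 * X l := by
      rw [X, monomial_mul, one_mul]
    have h2 : (α + Finsupp.single l 1).degree = α.degree + 1 := by simp
    simp only [AddMonoidHom.coe_mulLeft, h1, h2, smul_eq_C_mul, map_pow, map_sub, map_one]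
    ring

lemma dilate_dilate_inv {c : ℂ} (hc : c ≠ 0) (P : MvPolynomial (Fin n) ℂ) :
    dilate c (dilate c⁻¹ P) = P := by
  have : (dilate c).comp (dilate c⁻¹) = AlgHom.id ℂ (MvPolynomial (Fin n) ℂ) := by
    ext l : 1
    simp only [AlgHom.comp_apply, dilate_X, map_mul, dilate_C, AlgHom.id_apply]
    rw [← mul_assoc, ← map_mul, inv_mul_cancel₀ hc, map_one, one_mul]
  exact DFunLike.congr_fun this P

section DerivativeClosed

/-- A space of polynomials that is stable under all partial derivatives. -/
def PDerivClosed (V : Submodule ℂ (MvPolynomial (Fin n) ℂ)) : Prop :=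
  ∀ l, ∀ Q ∈ V, pderiv l Q ∈ V

lemma PDerivClosed.iterPDeriv_mem {V : Submodule ℂ (MvPolynomial (Fin n) ℂ)} (hV : PDerivClosed V)
    {Q : MvPolynomial (Fin n) ℂ} (hQ : Q ∈ V) (α : Fin n →₀ ℕ) : iterPDeriv α Q ∈ V := by
  induction hN : α.degree generalizing α with
  | zero => rwa [(Finsupp.degree_eq_zero_iff α).1 hN, iterPDeriv_zero]
  | succ N ih =>
    obtain ⟨l, hl⟩ : ∃ l, α l ≠ 0 := by
      by_contra! h
      have : α = 0 := Finsupp.ext h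
      simp [this] at hN
    have hle : Finsupp.single l 1 ≤ α := by
      rw [Finsupp.single_le_iff]; omega
    rw [← tsub_add_cancel_of_le hle, map_add, Finsupp.degree_single] at hN
    rw [← tsub_add_cancel_of_le hle, ← pderiv_iterPDeriv]
    exact hV l _ (ih _ (by omega))

lemma PDerivClosed.taylorCoeff_mem {V : Submodule ℂ (MvPolynomial (Fin n) ℂ)}
    (hV : PDerivClosed V) {Q : MvPolynomial (Fin n) ℂ} (hQ : Q ∈ V) (α : Fin n →₀ ℕ) :
    taylorCoeff α Q ∈ V := by
  have h := V.smul_mem ((indexFactorial α : ℂ)⁻¹) (hV.iterPDeriv_mem hQ α)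
  rwa [iterPDeriv_apply, ← Nat.cast_smul_eq_nsmul ℂ, smul_smul, inv_mul_cancel₀, one_smul] at h
  exact_mod_cast (indexFactorial_pos α).ne'

/-- The span of all derivatives of positive order of `P`. -/
def derivSpan (P : MvPolynomial (Fin n) ℂ) : Submodule ℂ (MvPolynomial (Fin n) ℂ) :=
  Submodule.span ℂ ((fun α => taylorCoeff α P) '' taylorSupp P)

lemma taylorCoeff_mem_derivSpan (P : MvPolynomial (Fin n) ℂ) {α : Fin n →₀ ℕ} (hα : α ≠ 0) :
    taylorCoeff α P ∈ derivSpan P := by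
  by_cases h : α ∈ taylorSupp P
  · exact Submodule.subset_span ⟨α, h, rfl⟩
  · have : taylorCoeff α P = 0 := by
      rw [taylorCoeff_apply, ← notMem_support_iff]
      exact fun h' => h (Finset.mem_erase.2 ⟨hα, h'⟩)
    rw [this]
    exact Submodule.zero_mem _

lemma iterPDeriv_mem_derivSpan (P : MvPolynomial (Fin n) ℂ) {α : Fin n →₀ ℕ} (hα : α ≠ 0) :
    iterPDeriv α P ∈ derivSpan P := by
  rw [iterPDeriv_apply, ← Nat.cast_smul_eq_nsmul ℂ]
  exact Submodule.smul_mem _ _ (taylorCoeff_mem_derivSpan P hα)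

lemma pderivClosed_derivSpan (P : MvPolynomial (Fin n) ℂ) : PDerivClosed (derivSpan P) := by
  intro l Q hQ
  induction hQ using Submodule.span_induction with
  | mem Q h =>
    obtain ⟨α, _, rfl⟩ := h
    rw [pderiv_taylorCoeff, ← Nat.cast_smul_eq_nsmul ℂ]
    refine Submodule.smul_mem _ _ (taylorCoeff_mem_derivSpan P fun h => ?_)
    have := DFunLike.congr_fun h l
    simp at this
  | zero => simp
  | add Q R _ _ hQ hR => rw [map_add]; exact Submodule.add_mem _ hQ hR
  | smul c Q _ hQ => rw [Derivation.map_smul]; exact Submodule.smul_mem _ _ hQ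

/-- The polynomials `∑ X^β Q_β` with `Q_β ∈ V` and `|β| ≤ b`. -/
def mulDegLE (V : Submodule ℂ (MvPolynomial (Fin n) ℂ)) :
    ℕ → Submodule ℂ (MvPolynomial (Fin n) ℂ)
  | 0 => V
  | b + 1 => mulDegLE V b ⊔ ⨆ l, (mulDegLE V b).map (LinearMap.mulLeft ℂ (X l))

lemma X_mul_mem_mulDegLE {V : Submodule ℂ (MvPolynomial (Fin n) ℂ)} {b : ℕ} (l : Fin n)
    {Q : MvPolynomial (Fin n) ℂ} (hQ : Q ∈ mulDegLE V b) : X l * Q ∈ mulDegLE V (b + 1) :=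
  Submodule.mem_sup_right (Submodule.mem_iSup_of_mem l ⟨Q, hQ, rfl⟩)

/-- Induction principle for `mulDegLE V (b + 1)`. -/
lemma mulDegLE_succ_le {V W : Submodule ℂ (MvPolynomial (Fin n) ℂ)} {b : ℕ}
    (h₀ : mulDegLE V b ≤ W) (h₁ : ∀ l, ∀ Q ∈ mulDegLE V b, X l * Q ∈ W) :
    mulDegLE V (b + 1) ≤ W := by
  refine sup_le h₀ (iSup_le fun l => ?_)
  rintro _ ⟨Q, hQ, rfl⟩
  exact h₁ l Q hQ

lemma monomial_mul_mem_mulDegLE {V : Submodule ℂ (MvPolynomial (Fin n) ℂ)} {b : ℕ}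
    {Q : MvPolynomial (Fin n) ℂ} (hQ : Q ∈ mulDegLE V b) (β : Fin n →₀ ℕ) :
    monomial β 1 * Q ∈ mulDegLE V (b + β.degree) := by
  induction hN : β.degree generalizing β with
  | zero =>
    rw [(Finsupp.degree_eq_zero_iff β).1 hN]
    simpa using hQ
  | succ N ih =>
    obtain ⟨l, hl⟩ : ∃ l, β l ≠ 0 := by
      by_contra! h
      have : β = 0 := Finsupp.ext h
      simp [this] at hN
    have hle : Finsupp.single l 1 ≤ β := by
      rw [Finsupp.single_le_iff]; omega
    rw [← tsub_add_cancel_of_le hle, map_add, Finsupp.degree_single] at hN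
    rw [← tsub_add_cancel_of_le hle]
    have h1 : (monomial (β - Finsupp.single l 1 + Finsupp.single l 1) 1 : MvPolynomial (Fin n) ℂ)
        = X l * monomial (β - Finsupp.single l 1) 1 := by
      rw [X, monomial_mul, one_mul, add_comm]
    rw [h1, mul_assoc]
    exact X_mul_mem_mulDegLE l (ih _ (by omega))

lemma PDerivClosed.mulDegLE {V : Submodule ℂ (MvPolynomial (Fin n) ℂ)} (hV : PDerivClosed V)
    (b : ℕ) : PDerivClosed (mulDegLE V b) := by
  induction b with
  | zero => exact hV
  | succ b ih =>
    intro l Q hQ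
    refine mulDegLE_succ_le (W := (MvPolynomial.mulDegLE V (b + 1)).comap
      (pderiv l).toLinearMap) (fun Q hQ => Submodule.mem_sup_left (ih l Q hQ)) ?_ hQ
    intro k Q hQ
    change pderiv l (X k * Q) ∈ MvPolynomial.mulDegLE V (b + 1)
    rw [pderiv_mul]
    refine Submodule.add_mem _ ?_ (X_mul_mem_mulDegLE k (ih l Q hQ))
    by_cases h : k = l
    · subst h
      rw [pderiv_X_self, one_mul]
      exact Submodule.mem_sup_left hQ
    · rw [pderiv_X_of_ne h, zero_mul]
      exact Submodule.zero_mem _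

end DerivativeClosed

end MvPolynomial

namespace EntireGrowth

open MvPolynomial (X C pderiv taylorSupp taylorCoeff iterPDeriv dilate)

variable {n : ℕ}

/-- The differential operator `P(∂/∂z)` on entire functions of Gaussian growth. -/
def diffOp : MvPolynomial (Fin n) ℂ →ₐ[ℂ] Module.End ℂ (EntireGrowth n) :=
  (MvPolynomial.exists_algHom_of_commute dz dz_comm).choose

/-- Multiplication by `P(z)` on entire functions of Gaussian growth. -/
def evalOp : MvPolynomial (Fin n) ℂ →ₐ[ℂ] Module.End ℂ (EntireGrowth n) :=
  (MvPolynomial.exists_algHom_of_commute mulz mulz_comm).choose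

/-- Multiplication by `P*(z)` on entire functions of Gaussian growth. -/
def mulOp : MvPolynomial (Fin n) ℂ →+* Module.End ℂ (EntireGrowth n) :=
  (evalOp (n := n)).toRingHom.comp (MvPolynomial.map (starRingEnd ℂ))

lemma diffOp_X (l : Fin n) : diffOp (X l) = dz l :=
  (MvPolynomial.exists_algHom_of_commute dz dz_comm).choose_spec l

lemma evalOp_X (l : Fin n) : evalOp (X l) = mulz l :=
  (MvPolynomial.exists_algHom_of_commute mulz mulz_comm).choose_spec l

lemma mulOp_X (l : Fin n) : mulOp (X l) = mulz l := by
  simp [mulOp, evalOp_X]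

lemma diffOp_C (a : ℂ) (f : EntireGrowth n) : diffOp (C a) f = a • f := by
  rw [← MvPolynomial.algebraMap_eq, AlgHom.commutes]
  rfl

lemma mulOp_C (a : ℂ) (f : EntireGrowth n) : mulOp (C a) f = (starRingEnd ℂ) a • f := by
  have : mulOp (n := n) (C a) = evalOp (C ((starRingEnd ℂ) a)) := by simp [mulOp]
  rw [this, ← MvPolynomial.algebraMap_eq, AlgHom.commutes]
  rfl

lemma diffOp_smul (c : ℂ) (P : MvPolynomial (Fin n) ℂ) (f : EntireGrowth n) :
    diffOp (c • P) f = c • diffOp P f := by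
  rw [map_smul]; rfl

lemma mulOp_smul (c : ℂ) (P : MvPolynomial (Fin n) ℂ) (f : EntireGrowth n) :
    mulOp (c • P) f = (starRingEnd ℂ) c • mulOp P f := by
  rw [MvPolynomial.smul_eq_C_mul, map_mul, Module.End.mul_apply, mulOp_C]

lemma coe_diffOp (P : MvPolynomial (Fin n) ℂ) (f : EntireGrowth n) :
    (diffOp P f : Cn n → ℂ) = polyD P f := by
  have hpow : ∀ (j : Fin n) (k : ℕ) (g : EntireGrowth n),
      ((dz j ^ k) g : Cn n → ℂ) = pdzPow j k g := by
    intro j k g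
    induction k with
    | zero => rfl
    | succ k ih => rw [pow_succ', Module.End.mul_apply, dz_apply, ih]; rfl
  have hlist : ∀ (m : Fin n →₀ ℕ) (L : List (Fin n)),
      (((L.map fun j => dz j ^ m j).prod f : EntireGrowth n) : Cn n → ℂ)
        = L.foldr (fun j g => pdzPow j (m j) g) f := by
    intro m L
    induction L with
    | nil => rfl
    | cons j L ih =>
      rw [List.map_cons, List.prod_cons, Module.End.mul_apply, hpow, ih, List.foldr_cons]
  have hmono : ∀ (m : Fin n →₀ ℕ) (a : ℂ),
      (diffOp (MvPolynomial.monomial m a) f : Cn n → ℂ) = a • applyMono m f := by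
    intro m a
    rw [applyMono, ← hlist, MvPolynomial.monomial_eq, map_mul, Module.End.mul_apply, diffOp_C,
      Finsupp.prod_fintype _ _ (fun _ => pow_zero _), Fin.prod_univ_def, map_list_prod,
      List.map_map]
    simp only [Function.comp_def, map_pow, diffOp_X]
    rfl
  conv_lhs => rw [P.as_sum, map_sum, LinearMap.sum_apply]
  rw [Submodule.coe_sum]
  ext z
  simp only [Finset.sum_apply, hmono, polyD, Pi.smul_apply, smul_eq_mul]

lemma coe_mulOp (P : MvPolynomial (Fin n) ℂ) (f : EntireGrowth n) :
    (mulOp P f : Cn n → ℂ) = pMul P f := by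
  induction P using MvPolynomial.induction_on generalizing f with
  | C a => rw [mulOp_C]; ext z; simp [pMul]
  | add P Q hP hQ =>
    rw [map_add, LinearMap.add_apply, Submodule.coe_add, hP, hQ]
    ext z; simp [pMul, add_mul]
  | mul_X P l hP =>
    rw [map_mul, Module.End.mul_apply, hP, mulOp_X]
    ext z; simp [pMul, mulz_apply, mul_assoc]

lemma dz_mul_mulOp (l : Fin n) (Q : MvPolynomial (Fin n) ℂ) :
    dz l * mulOp Q = mulOp Q * dz l + mulOp (pderiv l Q) := by
  induction Q using MvPolynomial.induction_on with
  | C a =>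
    rw [MvPolynomial.pderiv_C, map_zero, add_zero]
    ext1 f
    simp only [Module.End.mul_apply, mulOp_C, map_smul]
  | add P Q hP hQ => rw [map_add, map_add, map_add, mul_add, add_mul, hP, hQ]; abel
  | mul_X P k hP =>
    rw [map_mul, ← mul_assoc, hP, mulOp_X, add_mul, mul_assoc, dz_mul_mulz, MvPolynomial.pderiv_mul,
      map_add, map_mul, map_mul, mulOp_X, mul_add, ← mul_assoc]
    by_cases h : l = k
    · subst h
      rw [if_pos rfl, MvPolynomial.pderiv_X_self, map_one]
      abel
    · rw [if_neg h, MvPolynomial.pderiv_X_of_ne (Ne.symm h), map_zero]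
      abel

lemma diffOp_mul_mulOp (P Q : MvPolynomial (Fin n) ℂ) :
    diffOp P * mulOp Q = mulOp Q * diffOp P +
      ∑ α ∈ taylorSupp P, mulOp (iterPDeriv α Q) * diffOp (taylorCoeff α P) := by
  have h := MvPolynomial.taylor_expansion (n := n)
    ((AddMonoidHom.mulRight (mulOp Q)).comp (diffOp (n := n)).toRingHom.toAddMonoidHom)
    (fun α => (AddMonoidHom.mulLeft (mulOp (iterPDeriv α Q))).comp
      (diffOp (n := n)).toRingHom.toAddMonoidHom)
    (fun l => AddMonoidHom.mulLeft (dz l)) ?_ ?_ ?_ P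
  · simpa [MvPolynomial.iterPDeriv_zero] using h
  · intro a
    ext1 f
    simp [MvPolynomial.iterPDeriv_zero]
  · intro P l
    have : diffOp (P * X l) = dz l * diffOp P := by rw [mul_comm, map_mul, diffOp_X]
    simp [this, mul_assoc]
  · intro l α P
    have : diffOp (P * X l) = dz l * diffOp P := by rw [mul_comm, map_mul, diffOp_X]
    simp [this, ← mul_assoc, dz_mul_mulOp, MvPolynomial.pderiv_iterPDeriv, add_mul]

lemma mulOp_mul_diffOp (P Q : MvPolynomial (Fin n) ℂ) :
    mulOp Q * diffOp P = diffOp P * mulOp Q +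
      ∑ α ∈ taylorSupp P,
        (-1 : ℂ) ^ α.degree • (diffOp (taylorCoeff α P) * mulOp (iterPDeriv α Q)) := by
  have h := MvPolynomial.taylor_expansion (n := n)
    ((AddMonoidHom.mulLeft (mulOp Q)).comp (diffOp (n := n)).toRingHom.toAddMonoidHom)
    (fun α => (AddMonoidHom.mulRight ((-1 : ℂ) ^ α.degree • mulOp (iterPDeriv α Q))).comp
      (diffOp (n := n)).toRingHom.toAddMonoidHom)
    (fun l => AddMonoidHom.mulRight (dz l)) ?_ ?_ ?_ P
  · simpa [MvPolynomial.iterPDeriv_zero] using h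
  · intro a
    ext1 f
    simp [MvPolynomial.iterPDeriv_zero]
  · intro P l
    simp [diffOp_X, mul_assoc]
  · intro l α P
    have h2 : (α + Finsupp.single l 1).degree = α.degree + 1 := by simp
    have h3 : mulOp (iterPDeriv α Q) * dz l = dz l * mulOp (iterPDeriv α Q)
        - mulOp (iterPDeriv (α + Finsupp.single l 1) Q) := by
      rw [dz_mul_mulOp, MvPolynomial.pderiv_iterPDeriv]; abel
    simp only [AddMonoidHom.comp_apply, AddMonoidHom.coe_mulRight, h2, pow_succ]
    simp only [mul_neg, mul_one, AlgHom.toRingHom_eq_coe, RingHom.toAddMonoidHom_eq_coe,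
      AddMonoidHom.coe_coe, RingHom.coe_coe, map_mul, diffOp_X, mul_smul_comm, smul_mul_assoc,
      mul_assoc, h3]
    rw [mul_sub (diffOp P), smul_sub, sub_eq_add_neg]
    exact congrArg _ (neg_smul _ _).symm

lemma pairing_diffOp {s : ℝ} (hs : 1 < s) (P : MvPolynomial (Fin n) ℂ) (f g : EntireGrowth n) :
    pairing s (diffOp P f) g = pairing s f (mulOp (dilate s P) g) := by
  induction P using MvPolynomial.induction_on generalizing f g with
  | C a => rw [diffOp_C, MvPolynomial.dilate_C, mulOp_C, pairing_smul_left, pairing_smul_right]; simp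
  | add P Q hP hQ =>
    rw [map_add, map_add, map_add, LinearMap.add_apply, LinearMap.add_apply, pairing_add_left hs,
      pairing_add_right hs, hP, hQ]
  | mul_X P l hP =>
    rw [map_mul, Module.End.mul_apply, hP, diffOp_X, pairing_dz hs, map_mul, MvPolynomial.dilate_X,
      mul_comm (dilate (s : ℂ) P), map_mul, map_mul, mul_assoc, Module.End.mul_apply, mulOp_C,
      pairing_smul_right, Module.End.mul_apply, mulOp_X]
    simp

lemma pairing_diffOp_right {s : ℝ} (hs : 1 < s) (P : MvPolynomial (Fin n) ℂ)
    (f g : EntireGrowth n) :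
    pairing s f (diffOp P g) = pairing s (mulOp (dilate s P) f) g := by
  rw [← pairing_conj, pairing_diffOp hs, pairing_conj]

lemma pairing_mulOp {s : ℝ} (hs : 1 < s) (P : MvPolynomial (Fin n) ℂ) (f g : EntireGrowth n) :
    pairing s (mulOp P f) g = pairing s f (diffOp (dilate (s⁻¹ : ℝ) P) g) := by
  have h0 : (s : ℂ) ≠ 0 := by exact_mod_cast (by linarith : s ≠ 0)
  rw [pairing_diffOp_right hs, ofReal_inv, MvPolynomial.dilate_dilate_inv h0]

lemma pairing_mulOp_right {s : ℝ} (hs : 1 < s) (P : MvPolynomial (Fin n) ℂ)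
    (f g : EntireGrowth n) :
    pairing s f (mulOp P g) = pairing s (diffOp (dilate (s⁻¹ : ℝ) P) f) g := by
  rw [← pairing_conj, pairing_mulOp hs, pairing_conj]

end EntireGrowth

namespace EntireGrowth

open Asymptotics Topology

variable {n : ℕ}

lemma pairing_self (s : ℝ) (f : EntireGrowth n) :
    pairing s f f = (∫ z, ‖(f : Cn n → ℂ) z‖ ^ 2 * gaussWt s z : ℝ) := by
  rw [pairing, ← integral_complex_ofReal]
  congr 1; funext z
  rw [mul_conj, normSq_eq_norm_sq]
  push_cast; ring

lemma pairing_self_re_nonneg (s : ℝ) (f : EntireGrowth n) : 0 ≤ (pairing s f f).re := by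
  rw [pairing_self, ofReal_re]
  exact integral_nonneg fun z => mul_nonneg (sq_nonneg _) (gaussWt_pos s z).le

/-- The semi-inner product `(g, f) ↦ ∫ f ḡ e^{-s|z|²}`. -/
@[reducible]
def innerCore {s : ℝ} (hs : 1 < s) : PreInnerProductSpace.Core ℂ (EntireGrowth n) where
  inner f g := pairing s g f
  conj_inner_symm f g := pairing_conj s f g
  re_inner_nonneg f := pairing_self_re_nonneg s f
  add_left f g h := pairing_add_right hs h f g
  smul_left f g r := pairing_smul_right s r g f

/-- The norm of `f` in `L²(e^{-s|z|²})`. -/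
def gaussNorm (s : ℝ) (f : EntireGrowth n) : ℝ := √(pairing s f f).re

lemma gaussNorm_nonneg (s : ℝ) (f : EntireGrowth n) : 0 ≤ gaussNorm s f := Real.sqrt_nonneg _

lemma gaussNorm_sq (s : ℝ) (f : EntireGrowth n) : gaussNorm s f ^ 2 = (pairing s f f).re :=
  Real.sq_sqrt (pairing_self_re_nonneg s f)

lemma pairing_self_eq (s : ℝ) (f : EntireGrowth n) :
    pairing s f f = ((gaussNorm s f ^ 2 : ℝ) : ℂ) := by
  rw [gaussNorm_sq, pairing_self, ofReal_re]

lemma gaussNorm_add_le {s : ℝ} (hs : 1 < s) (f g : EntireGrowth n) :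
    gaussNorm s (f + g) ≤ gaussNorm s f + gaussNorm s g :=
  letI := InnerProductSpace.Core.toNorm (c := innerCore (n := n) hs) (𝕜 := ℂ)
  (InnerProductSpace.Core.toSeminormedSpaceCore (innerCore hs)).norm_triangle f g

lemma gaussNorm_smul {s : ℝ} (hs : 1 < s) (c : ℂ) (f : EntireGrowth n) :
    gaussNorm s (c • f) = ‖c‖ * gaussNorm s f :=
  letI := InnerProductSpace.Core.toNorm (c := innerCore (n := n) hs) (𝕜 := ℂ)
  (InnerProductSpace.Core.toSeminormedSpaceCore (innerCore hs)).norm_smul c f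

lemma norm_pairing_le {s : ℝ} (hs : 1 < s) (f g : EntireGrowth n) :
    ‖pairing s f g‖ ≤ gaussNorm s f * gaussNorm s g := by
  let := innerCore (n := n) hs
  rw [mul_comm]
  exact InnerProductSpace.Core.norm_inner_le_norm (𝕜 := ℂ) g f

lemma one_lt_scale {t : ℝ} (ht : 0 < t) : 1 < 1 + t ^ 4 := by
  have := pow_pos ht 4
  linarith

lemma eventually_pos : ∀ᶠ t : ℝ in 𝓝[>] 0, 0 < t := self_mem_nhdsWithin

lemma isBigO_zpow_of_le {a b : ℤ} (h : a ≤ b) :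
    (fun t : ℝ => t ^ b) =O[𝓝[>] 0] fun t => t ^ a := by
  refine IsBigO.of_bound 1 ?_
  filter_upwards [eventually_pos, Ioo_mem_nhdsGT (zero_lt_one' ℝ)] with t ht ht1
  rw [one_mul, Real.norm_of_nonneg (zpow_nonneg ht.le _),
    Real.norm_of_nonneg (zpow_nonneg ht.le _)]
  exact zpow_le_zpow_right_of_le_one₀ ht ht1.2.le h

lemma isBigO_mul_zpow {F G : ℝ → ℂ} {a b : ℤ} (hF : F =O[𝓝[>] 0] fun t : ℝ => t ^ a)
    (hG : G =O[𝓝[>] 0] fun t : ℝ => t ^ b) :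
    (fun t => F t * G t) =O[𝓝[>] 0] fun t : ℝ => t ^ (a + b) := by
  refine (hF.mul hG).congr' EventuallyEq.rfl ?_
  filter_upwards [eventually_pos] with t ht
  rw [zpow_add₀ ht.ne']

/-- The functions whose norm in `L²(e^{-(1+t⁴)|z|²})` is `O(t^a)` as `t → 0+`. -/
def growthLE (n : ℕ) (a : ℤ) : Submodule ℂ (EntireGrowth n) where
  carrier := {f | (fun t : ℝ => gaussNorm (1 + t ^ 4) f) =O[𝓝[>] 0] fun t => t ^ a}
  zero_mem' := by
    have : ∀ t : ℝ, gaussNorm (1 + t ^ 4) (0 : EntireGrowth n) = 0 := by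
      intro t; simp [gaussNorm, pairing]
    simp only [Set.mem_ofPred_eq, this]
    exact isBigO_zero _ _
  add_mem' {f g} hf hg := by
    refine IsBigO.trans (IsBigO.of_bound 1 ?_) (IsBigO.add hf hg)
    filter_upwards [eventually_pos] with t ht
    rw [one_mul, Real.norm_of_nonneg (gaussNorm_nonneg _ _), Real.norm_of_nonneg
      (add_nonneg (gaussNorm_nonneg _ _) (gaussNorm_nonneg _ _))]
    exact gaussNorm_add_le (one_lt_scale ht) f g
  smul_mem' c f hf := by
    refine (IsBigO.const_mul_left hf ‖c‖).congr' ?_ EventuallyEq.rfl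
    filter_upwards [eventually_pos] with t ht
    rw [gaussNorm_smul (one_lt_scale ht)]

lemma mem_growthLE {a : ℤ} {f : EntireGrowth n} : f ∈ growthLE n a ↔
    (fun t : ℝ => gaussNorm (1 + t ^ 4) f) =O[𝓝[>] 0] fun t => t ^ a := Iff.rfl

lemma growthLE_mono {a b : ℤ} (h : a ≤ b) : growthLE n b ≤ growthLE n a :=
  fun _ hf => IsBigO.trans hf (isBigO_zpow_of_le h)

lemma isBigO_pairing {a b : ℤ} {f g : EntireGrowth n} (hf : f ∈ growthLE n a)
    (hg : g ∈ growthLE n b) :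
    (fun t : ℝ => pairing (1 + t ^ 4) f g) =O[𝓝[>] 0] fun t : ℝ => t ^ (a + b) := by
  refine IsBigO.trans (IsBigO.of_bound 1 ?_) ((IsBigO.mul hf hg).congr' EventuallyEq.rfl ?_)
  · filter_upwards [eventually_pos] with t ht
    rw [one_mul, Real.norm_of_nonneg (mul_nonneg (gaussNorm_nonneg _ _) (gaussNorm_nonneg _ _))]
    exact norm_pairing_le (one_lt_scale ht) f g
  · filter_upwards [eventually_pos] with t ht
    rw [zpow_add₀ ht.ne']

lemma mem_growthLE_of_sq {a : ℤ} {f : EntireGrowth n}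
    (h : (fun t : ℝ => gaussNorm (1 + t ^ 4) f ^ 2) =O[𝓝[>] 0] fun t => t ^ (2 * a)) :
    f ∈ growthLE n a := by
  rw [mem_growthLE]
  refine IsBigO.of_pow two_ne_zero (h.congr' EventuallyEq.rfl ?_)
  filter_upwards [eventually_pos] with t ht
  rw [mul_comm, zpow_mul]; norm_cast

lemma gaussNorm_sq_le_fNormSq {s : ℝ} (hs : 1 < s) {f : EntireGrowth n}
    (hf : MemF (f : Cn n → ℂ)) : gaussNorm s f ^ 2 ≤ fNormSq (f : Cn n → ℂ) := by
  rw [gaussNorm_sq, pairing_self, ofReal_re]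
  refine integral_mono (f.2.2 _ hs) hf.2 fun z => ?_
  rw [← gaussWt_one]
  exact mul_le_mul_of_nonneg_left (gaussWt_anti hs.le z) (sq_nonneg _)

lemma mem_growthLE_zero_of_memF {f : EntireGrowth n} (hf : MemF (f : Cn n → ℂ)) :
    f ∈ growthLE n 0 := by
  refine mem_growthLE_of_sq (IsBigO.of_bound (fNormSq (f : Cn n → ℂ)) ?_)
  filter_upwards [eventually_pos] with t ht
  rw [Real.norm_of_nonneg (sq_nonneg _), mul_zero, zpow_zero, norm_one, mul_one]
  exact gaussNorm_sq_le_fNormSq (one_lt_scale ht) hf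

lemma mulz_mem_growthLE (l : Fin n) {a : ℤ} {f : EntireGrowth n} (hf : f ∈ growthLE n a) :
    mulz l f ∈ growthLE n (a - 2) := by
  have hhalf : Tendsto (fun t : ℝ => t / 2) (𝓝[>] 0) (𝓝[>] 0) := by
    refine tendsto_nhdsWithin_iff.2 ⟨?_, ?_⟩
    · have : Tendsto (fun t : ℝ => t / 2) (𝓝 0) (𝓝 (0 / 2)) := tendsto_id.div_const 2
      rw [zero_div] at this
      exact this.mono_left nhdsWithin_le_nhds
    · filter_upwards [eventually_pos] with t ht using half_pos ht
  have h2 : (fun t : ℝ => gaussNorm (1 + (t / 2) ^ 4) f) =O[𝓝[>] 0] fun t => (t / 2) ^ a :=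
    hf.comp_tendsto hhalf
  have h3 : (fun t : ℝ => (t / 2) ^ a) =O[𝓝[>] 0] fun t => t ^ a := by
    simp only [div_zpow]
    simp only [div_eq_mul_inv, mul_comm _ ((2 : ℝ) ^ a)⁻¹]
    exact (isBigO_refl _ _).const_mul_left _
  have h4 : (fun t : ℝ => gaussNorm (1 + t ^ 4) (mulz l f)) =O[𝓝[>] 0]
      fun t => t ^ (-2 : ℤ) * gaussNorm (1 + (t / 2) ^ 4) f := by
    refine IsBigO.of_bound 2 ?_
    filter_upwards [eventually_pos] with t ht
    have h0 : 0 ≤ t ^ (-2 : ℤ) * gaussNorm (1 + (t / 2) ^ 4) f :=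
      mul_nonneg (zpow_nonneg ht.le _) (gaussNorm_nonneg _ _)
    rw [Real.norm_of_nonneg (gaussNorm_nonneg _ _), Real.norm_of_nonneg h0]
    refine abs_le_of_sq_le_sq' ?_ (by positivity) |>.2
    have hb := (integrable_normSq_coord_mul l f (one_lt_scale (half_pos ht))
      (s := 1 + t ^ 4) (by have := pow_pos ht 4; linarith [div_pow t 2 4])).2
    have e1 : gaussNorm (1 + t ^ 4) (mulz l f) ^ 2 =
        ∫ z, ‖z l * (f : Cn n → ℂ) z‖ ^ 2 * gaussWt (1 + t ^ 4) z := by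
      rw [gaussNorm_sq, pairing_self, ofReal_re]; rfl
    have e2 : gaussNorm (1 + (t / 2) ^ 4) f ^ 2 =
        ∫ z, ‖(f : Cn n → ℂ) z‖ ^ 2 * gaussWt (1 + (t / 2) ^ 4) z := by
      rw [gaussNorm_sq, pairing_self, ofReal_re]
    rw [← e1, ← e2] at hb
    refine hb.trans ?_
    rw [mul_pow, mul_pow, ← mul_assoc]
    refine mul_le_mul_of_nonneg_right ?_ (sq_nonneg _)
    have e3 : 1 + t ^ 4 - (1 + (t / 2) ^ 4) = 15 / 16 * t ^ 4 := by ring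
    have e4 : (t ^ (-2 : ℤ)) ^ 2 = (t ^ 4)⁻¹ := by
      rw [zpow_neg, inv_pow]; norm_cast; ring
    rw [e3, e4, mul_inv]
    refine mul_le_mul_of_nonneg_right (by norm_num) (by positivity)
  refine h4.trans (((isBigO_refl _ _).mul (h2.trans h3)).congr' EventuallyEq.rfl ?_)
  filter_upwards [eventually_pos] with t ht
  rw [← zpow_add₀ ht.ne']
  congr 1; ring

lemma dz_mem_growthLE (l : Fin n) {a : ℤ} {f : EntireGrowth n} (hf : f ∈ growthLE n a) :
    dz l f ∈ growthLE n (a - 2) := by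
  refine IsBigO.trans (IsBigO.of_bound 2 ?_) (mulz_mem_growthLE l hf)
  filter_upwards [eventually_pos, Ioo_mem_nhdsGT (zero_lt_one' ℝ)] with t ht ht1
  have hs := one_lt_scale ht
  have hs2 : 1 + t ^ 4 ≤ 2 := by
    have := pow_le_one₀ (n := 4) ht.le ht1.2.le
    linarith
  rw [Real.norm_of_nonneg (gaussNorm_nonneg _ _), Real.norm_of_nonneg (gaussNorm_nonneg _ _)]
  set s := 1 + t ^ 4
  have hkey : gaussNorm s (dz l f) ^ 2
      = s ^ 2 * gaussNorm s (mulz l f) ^ 2 - s * gaussNorm s f ^ 2 := by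
    have h1 : mulz l (dz l f) = dz l (mulz l f) + (-1 : ℂ) • f := by
      have := LinearMap.congr_fun (dz_mul_mulz l l) f
      rw [if_pos rfl] at this
      change dz l (mulz l f) = mulz l (dz l f) + f at this
      have hneg : (-1 : ℂ) • f = -f := neg_one_smul ℂ f
      rw [this, hneg, add_neg_cancel_right]
    have h2 : pairing s (dz l f) (dz l f)
        = s * (s * pairing s (mulz l f) (mulz l f) - pairing s f f) := by
      rw [pairing_dz hs, h1, pairing_add_right hs, pairing_smul_right, ← pairing_conj s (dz l _) f,
        pairing_dz hs, map_mul, pairing_conj, conj_ofReal]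
      simp only [map_neg, map_one]; ring
    rw [pairing_self_eq, pairing_self_eq, pairing_self_eq] at h2
    have h3 : gaussNorm s (dz l f) ^ 2
        = s * (s * gaussNorm s (mulz l f) ^ 2 - gaussNorm s f ^ 2) := by exact_mod_cast h2
    rw [h3]; ring
  have h0 := gaussNorm_nonneg s (mulz l f)
  have h5 : gaussNorm s (dz l f) ≤ s * gaussNorm s (mulz l f) := by
    refine abs_le_of_sq_le_sq' ?_ (by positivity) |>.2
    rw [hkey, mul_pow]
    have : 0 ≤ s * gaussNorm s f ^ 2 := by positivity
    linarith
  exact h5.trans (mul_le_mul_of_nonneg_right hs2 h0)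

end EntireGrowth

namespace EntireGrowth

open Asymptotics Topology
open MvPolynomial (X C pderiv taylorSupp taylorCoeff iterPDeriv dilate derivSpan mulDegLE
  PDerivClosed)

variable {n : ℕ}

/-- The additive functional `g ↦ ∫ f ḡ e^{-s|z|²}`. -/
def pairingHom {s : ℝ} (hs : 1 < s) (f : EntireGrowth n) : EntireGrowth n →+ ℂ :=
  AddMonoidHom.mk' (pairing s f) (pairing_add_right hs f)

lemma pairing_sub_right {s : ℝ} (hs : 1 < s) (f g h : EntireGrowth n) :
    pairing s f (g - h) = pairing s f g - pairing s f h := (pairingHom hs f).map_sub g h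

lemma pairing_sum_right {s : ℝ} (hs : 1 < s) (f : EntireGrowth n) {ι : Type*} (S : Finset ι)
    (g : ι → EntireGrowth n) : pairing s f (∑ i ∈ S, g i) = ∑ i ∈ S, pairing s f (g i) :=
  map_sum (pairingHom hs f) g S

lemma pairing_sub_left {s : ℝ} (hs : 1 < s) (f g h : EntireGrowth n) :
    pairing s (f - g) h = pairing s f h - pairing s g h := by
  rw [← pairing_conj, pairing_sub_right hs, map_sub, pairing_conj, pairing_conj]

lemma pairing_sum_left {s : ℝ} (hs : 1 < s) {ι : Type*} (S : Finset ι)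
    (f : ι → EntireGrowth n) (g : EntireGrowth n) :
    pairing s (∑ i ∈ S, f i) g = ∑ i ∈ S, pairing s (f i) g := by
  rw [← pairing_conj, pairing_sum_right hs, map_sum]
  simp_rw [pairing_conj]

/-- The common features of `Q ↦ Q(∂)u` and `Q ↦ Q*(z)u`: additivity, homogeneity up to an
automorphism of the scalars that fixes the reals, and a loss of `t²` per variable. -/
structure PolyAction (T : MvPolynomial (Fin n) ℂ →+ EntireGrowth n) : Prop where
  smul : ∀ (c : ℂ) Q, ∃ c' : ℂ, T (c • Q) = c' • T Q
  real_smul : ∀ (r : ℝ) Q, T ((r : ℂ) • Q) = (r : ℂ) • T Q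
  X_mul : ∀ l (a : ℤ) Q, T Q ∈ growthLE n a → T (X l * Q) ∈ growthLE n (a - 2)

/-- The map `Q ↦ Q(∂)u`. -/
def diffAt (u : EntireGrowth n) : MvPolynomial (Fin n) ℂ →+ EntireGrowth n :=
  AddMonoidHom.mk' (fun Q => diffOp Q u) fun P Q => by rw [map_add, LinearMap.add_apply]

/-- The map `Q ↦ Q*(z)u`. -/
def mulAt (u : EntireGrowth n) : MvPolynomial (Fin n) ℂ →+ EntireGrowth n :=
  AddMonoidHom.mk' (fun Q => mulOp Q u) fun P Q => by rw [map_add, LinearMap.add_apply]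

lemma polyAction_diffAt (u : EntireGrowth n) : PolyAction (diffAt u) where
  smul c Q := ⟨c, diffOp_smul c Q u⟩
  real_smul r Q := diffOp_smul r Q u
  X_mul l a Q hQ := by
    change diffOp (X l * Q) u ∈ _
    rw [map_mul, diffOp_X, Module.End.mul_apply]
    exact dz_mem_growthLE l hQ

lemma polyAction_mulAt (u : EntireGrowth n) : PolyAction (mulAt u) where
  smul c Q := ⟨_, mulOp_smul c Q u⟩
  real_smul r Q := (mulOp_smul r Q u).trans (by rw [conj_ofReal]; rfl)
  X_mul l a Q hQ := by
    change mulOp (X l * Q) u ∈ _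
    rw [map_mul, mulOp_X, Module.End.mul_apply]
    exact mulz_mem_growthLE l hQ

namespace PolyAction

variable {T : MvPolynomial (Fin n) ℂ →+ EntireGrowth n}

/-- The polynomials that `T` maps into `growthLE n a`. -/
def comap (hT : PolyAction T) (a : ℤ) : Submodule ℂ (MvPolynomial (Fin n) ℂ) where
  carrier := {Q | T Q ∈ growthLE n a}
  zero_mem' := by
    change T 0 ∈ growthLE n a
    rw [map_zero]; exact Submodule.zero_mem _
  add_mem' {P Q} hP hQ := by
    change T (P + Q) ∈ growthLE n a
    rw [map_add]; exact Submodule.add_mem _ hP hQ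
  smul_mem' c Q hQ := by
    change T (c • Q) ∈ growthLE n a
    obtain ⟨c', h⟩ := hT.smul c Q
    rw [h]; exact Submodule.smul_mem _ _ hQ

lemma mem_of_mulDegLE (hT : PolyAction T) {V : Submodule ℂ (MvPolynomial (Fin n) ℂ)} {a : ℤ}
    (hV : ∀ Q ∈ V, T Q ∈ growthLE n a) (b : ℕ) :
    ∀ Q ∈ mulDegLE V b, T Q ∈ growthLE n (a - 2 * b) := by
  induction b with
  | zero => simpa [mulDegLE] using hV
  | succ b ih =>
    intro Q hQ
    refine MvPolynomial.mulDegLE_succ_le (W := hT.comap (a - 2 * (b + 1 : ℕ)))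
      (fun Q hQ => growthLE_mono (by push_cast; linarith) (ih Q hQ)) (fun l Q hQ => ?_) hQ
    have := hT.X_mul l _ Q (ih Q hQ)
    rwa [show a - 2 * (b : ℤ) - 2 = a - 2 * (b + 1 : ℕ) by push_cast; ring] at this

lemma monomial_mul_mem (hT : PolyAction T) {V : Submodule ℂ (MvPolynomial (Fin n) ℂ)} {a : ℤ}
    (hV : ∀ Q ∈ V, T Q ∈ growthLE n a) (β : Fin n →₀ ℕ) {Q : MvPolynomial (Fin n) ℂ}
    (hQ : Q ∈ V) : T (MvPolynomial.monomial β 1 * Q) ∈ growthLE n (a - 2 * β.degree) := by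
  have h := MvPolynomial.monomial_mul_mem_mulDegLE (V := V) (b := 0) hQ β
  rw [zero_add] at h
  exact hT.mem_of_mulDegLE hV _ _ h

lemma mem_of_derivSpan (hT : PolyAction T) {p : MvPolynomial (Fin n) ℂ} {a : ℤ}
    (h : ∀ α ∈ taylorSupp p, T (taylorCoeff α p) ∈ growthLE n a) :
    ∀ q ∈ derivSpan p, T q ∈ growthLE n a := by
  have : derivSpan p ≤ hT.comap a := by
    refine Submodule.span_le.2 ?_
    rintro _ ⟨α, hα, rfl⟩
    exact h α hα
  exact fun q hq => this hq

lemma exists_mem (hT : PolyAction T) (h1 : T 1 ∈ growthLE n 0) (Q : MvPolynomial (Fin n) ℂ) :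
    ∃ b : ℕ, T Q ∈ growthLE n (-b) := by
  induction Q using MvPolynomial.induction_on with
  | C a =>
    obtain ⟨c, hc⟩ := hT.smul a 1
    refine ⟨0, ?_⟩
    rw [← mul_one (C a), ← MvPolynomial.smul_eq_C_mul, hc]
    exact Submodule.smul_mem _ _ (by simpa using h1)
  | add P Q hP hQ =>
    obtain ⟨b, hb⟩ := hP
    obtain ⟨c, hc⟩ := hQ
    refine ⟨b + c, ?_⟩
    rw [map_add]
    exact Submodule.add_mem _ (growthLE_mono (by push_cast; linarith) hb)
      (growthLE_mono (by push_cast; linarith) hc)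
  | mul_X P l hP =>
    obtain ⟨b, hb⟩ := hP
    refine ⟨b + 2, ?_⟩
    rw [mul_comm]
    exact growthLE_mono (by push_cast; linarith) (hT.X_mul l _ P hb)

/-- If membership in `growthLE n a` on derivatives of `p` improves `a` to `a + 1` whenever
`a ≤ -1`, then it holds with `a = 0`. -/
lemma mem_zero_of_improve (hT : PolyAction T) (h1 : T 1 ∈ growthLE n 0)
    (p : MvPolynomial (Fin n) ℂ)
    (h : ∀ a : ℤ, a ≤ -1 → (∀ q ∈ derivSpan p, T q ∈ growthLE n a) →
      ∀ q ∈ derivSpan p, T q ∈ growthLE n (a + 1)) :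
    ∀ q ∈ derivSpan p, T q ∈ growthLE n 0 := by
  choose b hb using hT.exists_mem h1
  have hstart : ∀ q ∈ derivSpan p,
      T q ∈ growthLE n (-(((taylorSupp p).sup fun α => b (taylorCoeff α p) : ℕ) : ℤ)) := by
    refine hT.mem_of_derivSpan fun α hα => growthLE_mono ?_ (hb _)
    have := Finset.le_sup (f := fun α => b (taylorCoeff α p)) hα
    simp only [neg_le_neg_iff]
    exact_mod_cast this
  generalize (taylorSupp p).sup (fun α => b (taylorCoeff α p)) = N at hstart
  induction N with
  | zero => simpa using hstart
  | succ N ih =>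
    refine ih ?_
    have := h _ (by push_cast; linarith) hstart
    rwa [show -((N + 1 : ℕ) : ℤ) + 1 = -(N : ℤ) by push_cast; ring] at this

end PolyAction

lemma isBigO_scale : (fun t : ℝ => (1 + t ^ 4) - 1) =O[𝓝[>] 0] fun t => t ^ (4 : ℤ) := by
  refine (isBigO_refl _ _).congr_left fun t => ?_
  norm_cast; ring

lemma isBigO_inv_scale :
    (fun t : ℝ => (1 + t ^ 4)⁻¹ - 1) =O[𝓝[>] 0] fun t => t ^ (4 : ℤ) := by
  refine IsBigO.of_bound 1 (Eventually.of_forall fun t => ?_)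
  have h0 : 0 ≤ t ^ 4 := by positivity
  have h1 : (1 + t ^ 4)⁻¹ ≤ 1 := inv_le_one_of_one_le₀ (by linarith)
  have h2 : 1 - t ^ 4 ≤ (1 + t ^ 4)⁻¹ := by
    rw [← one_div, le_div_iff₀ (by linarith)]
    nlinarith
  rw [one_mul, show t ^ (4 : ℤ) = t ^ 4 by norm_cast, Real.norm_of_nonneg h0, Real.norm_eq_abs,
    abs_le]
  exact ⟨by linarith, by linarith⟩

/-- Replacing `Q` by a dilation with factor `1 + O(t⁴)` changes a pairing by a lower order term. -/
lemma isBigO_pairing_dilate_sub {T : MvPolynomial (Fin n) ℂ →+ EntireGrowth n}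
    (hT : PolyAction T) {c : ℝ → ℝ} (hc : (fun t => c t - 1) =O[𝓝[>] 0] fun t => t ^ (4 : ℤ))
    (f : EntireGrowth n) (Q : MvPolynomial (Fin n) ℂ) (e : ℤ)
    (h : ∀ β ∈ taylorSupp Q,
      (fun t : ℝ => pairing (1 + t ^ 4) f (T (MvPolynomial.monomial β 1 * taylorCoeff β Q)))
        =O[𝓝[>] 0] fun t => t ^ (e - 2 * β.degree)) :
    (fun t : ℝ => pairing (1 + t ^ 4) f (T (dilate (c t : ℝ) Q)) - pairing (1 + t ^ 4) f (T Q))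
      =O[𝓝[>] 0] fun t => t ^ (e + 2) := by
  have hsum : (fun t : ℝ => ∑ β ∈ taylorSupp Q, (((c t - 1) ^ β.degree : ℝ) : ℂ) *
      pairing (1 + t ^ 4) f (T (MvPolynomial.monomial β 1 * taylorCoeff β Q)))
      =O[𝓝[>] 0] fun t => t ^ (e + 2) := by
    refine IsBigO.fun_sum fun β hβ => ?_
    have hpow : (fun t => (((c t - 1) ^ β.degree : ℝ) : ℂ)) =O[𝓝[>] 0]
        fun t : ℝ => t ^ (4 * β.degree : ℤ) := by
      refine IsBigO.trans (IsBigO.of_bound 1 (Eventually.of_forall fun t => ?_))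
        ((hc.pow β.degree).congr_right fun t => ?_)
      · rw [one_mul, norm_real]
      · rw [zpow_mul]; norm_cast
    refine (isBigO_mul_zpow hpow (h β hβ)).trans (isBigO_zpow_of_le ?_)
    have : 1 ≤ β.degree := by
      rw [Nat.one_le_iff_ne_zero, Ne, Finsupp.degree_eq_zero_iff]
      exact MvPolynomial.ne_zero_of_mem_taylorSupp hβ
    have : (1 : ℤ) ≤ β.degree := by exact_mod_cast this
    linarith
  refine hsum.congr' ?_ EventuallyEq.rfl
  filter_upwards [eventually_pos] with t ht
  have hs := one_lt_scale ht
  rw [MvPolynomial.dilate_eq, map_add, pairing_add_right hs, add_sub_cancel_left, map_sum,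
    pairing_sum_right hs]
  refine Finset.sum_congr rfl fun β _ => ?_
  have : ((c t : ℂ) - 1) ^ β.degree = (((c t - 1) ^ β.degree : ℝ) : ℂ) := by push_cast; ring
  rw [this, hT.real_smul, pairing_smul_right, conj_ofReal]

end EntireGrowth

namespace EntireGrowth

open Asymptotics Topology
open MvPolynomial (X C pderiv taylorSupp taylorCoeff iterPDeriv dilate derivSpan mulDegLE
  PDerivClosed indexFactorial)

variable {n : ℕ}

lemma isBigO_pairing_dilate_sub_left {T : MvPolynomial (Fin n) ℂ →+ EntireGrowth n}
    (hT : PolyAction T) {c : ℝ → ℝ} (hc : (fun t => c t - 1) =O[𝓝[>] 0] fun t => t ^ (4 : ℤ))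
    (f : EntireGrowth n) (Q : MvPolynomial (Fin n) ℂ) (e : ℤ)
    (h : ∀ β ∈ taylorSupp Q,
      (fun t : ℝ => pairing (1 + t ^ 4) (T (MvPolynomial.monomial β 1 * taylorCoeff β Q)) f)
        =O[𝓝[>] 0] fun t => t ^ (e - 2 * β.degree)) :
    (fun t : ℝ => pairing (1 + t ^ 4) (T (dilate (c t : ℝ) Q)) f - pairing (1 + t ^ 4) (T Q) f)
      =O[𝓝[>] 0] fun t => t ^ (e + 2) := by
  have := isBigO_pairing_dilate_sub hT hc f Q e fun β hβ =>
    ((h β hβ).norm_left.congr_left fun t => by rw [← pairing_conj, norm_conj]).of_norm_left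
  refine (this.norm_left.congr_left fun t => ?_).of_norm_left
  rw [← pairing_conj _ f, ← pairing_conj _ f, ← map_sub, norm_conj]

lemma isBigO_pairing_dilate_sub_of_mem {T : MvPolynomial (Fin n) ℂ →+ EntireGrowth n}
    (hT : PolyAction T) {c : ℝ → ℝ} (hc : (fun t => c t - 1) =O[𝓝[>] 0] fun t => t ^ (4 : ℤ))
    {V : Submodule ℂ (MvPolynomial (Fin n) ℂ)} (hV : PDerivClosed V) {a b : ℤ}
    (hTV : ∀ Q ∈ V, T Q ∈ growthLE n a) {f : EntireGrowth n} (hf : f ∈ growthLE n b)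
    {Q : MvPolynomial (Fin n) ℂ} (hQ : Q ∈ V) :
    (fun t : ℝ => pairing (1 + t ^ 4) f (T (dilate (c t : ℝ) Q)) - pairing (1 + t ^ 4) f (T Q))
      =O[𝓝[>] 0] fun t => t ^ (a + b + 2) := by
  refine isBigO_pairing_dilate_sub hT hc f Q (a + b) fun β _ => ?_
  have := isBigO_pairing hf (hT.monomial_mul_mem hTV β (hV.taylorCoeff_mem hQ β))
  rwa [show b + (a - 2 * (β.degree : ℤ)) = a + b - 2 * β.degree by ring] at this

lemma isBigO_pairing_dilate_sub_left_of_mem {T : MvPolynomial (Fin n) ℂ →+ EntireGrowth n}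
    (hT : PolyAction T) {c : ℝ → ℝ} (hc : (fun t => c t - 1) =O[𝓝[>] 0] fun t => t ^ (4 : ℤ))
    {V : Submodule ℂ (MvPolynomial (Fin n) ℂ)} (hV : PDerivClosed V) {a b : ℤ}
    (hTV : ∀ Q ∈ V, T Q ∈ growthLE n a) {f : EntireGrowth n} (hf : f ∈ growthLE n b)
    {Q : MvPolynomial (Fin n) ℂ} (hQ : Q ∈ V) :
    (fun t : ℝ => pairing (1 + t ^ 4) (T (dilate (c t : ℝ) Q)) f - pairing (1 + t ^ 4) (T Q) f)
      =O[𝓝[>] 0] fun t => t ^ (a + b + 2) := by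
  refine isBigO_pairing_dilate_sub_left hT hc f Q (a + b) fun β _ => ?_
  have := isBigO_pairing (hT.monomial_mul_mem hTV β (hV.taylorCoeff_mem hQ β)) hf
  rwa [show a - 2 * (β.degree : ℤ) + b = a + b - 2 * β.degree by ring] at this

lemma isBigO_of_sub {F G : ℝ → ℂ} {k : ℝ → ℝ} (h : (fun t => F t - G t) =O[𝓝[>] 0] k)
    (hG : G =O[𝓝[>] 0] k) : F =O[𝓝[>] 0] k :=
  (h.add hG).congr_left fun _ => sub_add_cancel _ _

lemma commutator_apply (P Q : MvPolynomial (Fin n) ℂ) (u : EntireGrowth n) :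
    diffOp P (mulOp Q u) = mulOp Q (diffOp P u) +
      ∑ α ∈ taylorSupp P, mulOp (iterPDeriv α Q) (diffOp (taylorCoeff α P) u) := by
  have := LinearMap.congr_fun (diffOp_mul_mulOp P Q) u
  simpa using this

lemma commutator_apply' (P Q : MvPolynomial (Fin n) ℂ) (u : EntireGrowth n) :
    mulOp Q (diffOp P u) = diffOp P (mulOp Q u) +
      ∑ α ∈ taylorSupp P,
        (-1 : ℂ) ^ α.degree • diffOp (taylorCoeff α P) (mulOp (iterPDeriv α Q) u) := by
  have := LinearMap.congr_fun (mulOp_mul_diffOp P Q) u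
  simpa using this

/-- A bound on the quadratic form of `[p, p*]` at `u` bounds all `q(∂)u`, where `q` ranges over the
derivatives of `p`. -/
lemma diffOp_mem_growthLE_zero {p : MvPolynomial (Fin n) ℂ} {u : EntireGrowth n}
    (hu : u ∈ growthLE n 0)
    (hcomm : (fun t : ℝ => pairing (1 + t ^ 4) (diffOp p (mulOp p u) - mulOp p (diffOp p u)) u)
      =O[𝓝[>] 0] fun t => t ^ (0 : ℤ)) :
    ∀ q ∈ derivSpan p, diffOp q u ∈ growthLE n 0 := by
  have hT := polyAction_diffAt u
  refine hT.mem_zero_of_improve (by simpa [diffAt] using hu) p fun a ha hyp => ?_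
  refine hT.mem_of_derivSpan fun α hα => mem_growthLE_of_sq ?_
  have hmem : ∀ β ∈ taylorSupp p, taylorCoeff β p ∈ derivSpan p := fun β hβ =>
    MvPolynomial.taylorCoeff_mem_derivSpan p (MvPolynomial.ne_zero_of_mem_taylorSupp hβ)
  have hmem' : ∀ β ∈ taylorSupp p, iterPDeriv β p ∈ derivSpan p := fun β hβ =>
    MvPolynomial.iterPDeriv_mem_derivSpan p (MvPolynomial.ne_zero_of_mem_taylorSupp hβ)
  have herr : (fun t : ℝ => ∑ β ∈ taylorSupp p,
      (pairing (1 + t ^ 4) (diffAt u (taylorCoeff β p))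
          (diffAt u (dilate ((1 + t ^ 4)⁻¹ : ℝ) (iterPDeriv β p)))
        - pairing (1 + t ^ 4) (diffAt u (taylorCoeff β p)) (diffAt u (iterPDeriv β p))))
      =O[𝓝[>] 0] fun t => t ^ (2 * (a + 1)) := by
    refine IsBigO.fun_sum fun β hβ => ?_
    have := isBigO_pairing_dilate_sub_of_mem hT isBigO_inv_scale
      (MvPolynomial.pderivClosed_derivSpan p) hyp (hyp _ (hmem β hβ)) (hmem' β hβ)
    rwa [show a + a + 2 = 2 * (a + 1) by ring] at this
  have hsum : (fun t : ℝ => ((∑ β ∈ taylorSupp p, (indexFactorial β : ℝ) *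
      gaussNorm (1 + t ^ 4) (diffAt u (taylorCoeff β p)) ^ 2 : ℝ) : ℂ))
      =O[𝓝[>] 0] fun t => t ^ (2 * (a + 1)) := by
    refine ((hcomm.trans (isBigO_zpow_of_le (by linarith))).sub herr).congr' ?_ EventuallyEq.rfl
    filter_upwards [eventually_pos] with t ht
    have hs := one_lt_scale ht
    rw [commutator_apply, add_sub_cancel_left, pairing_sum_left hs, ← Finset.sum_sub_distrib,
      ofReal_sum]
    refine Finset.sum_congr rfl fun β _ => ?_
    have h1 : diffAt u (iterPDeriv β p) = (indexFactorial β : ℂ) • diffAt u (taylorCoeff β p) := by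
      rw [MvPolynomial.iterPDeriv_apply, map_nsmul, ← Nat.cast_smul_eq_nsmul ℂ]
    rw [pairing_mulOp hs, h1, pairing_smul_right, pairing_self_eq]
    simp [diffAt]
  refine IsBigO.trans (IsBigO.of_bound 1 (Eventually.of_forall fun t => ?_)) hsum
  rw [one_mul, norm_real, Real.norm_of_nonneg (sq_nonneg _), Real.norm_of_nonneg
    (Finset.sum_nonneg fun β _ => by positivity)]
  refine le_trans ?_ (Finset.single_le_sum (f := fun β => (indexFactorial β : ℝ) *
      gaussNorm (1 + t ^ 4) (diffAt u (taylorCoeff β p)) ^ 2) (fun β _ => by positivity) hα)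
  refine le_mul_of_one_le_left (sq_nonneg _) ?_
  exact_mod_cast MvPolynomial.indexFactorial_pos α

/-- A bound on the quadratic form of `[p, p*]` at `u` bounds all `q*(z)u`, where `q` ranges over the
derivatives of `p`. -/
lemma mulOp_mem_growthLE_zero {p : MvPolynomial (Fin n) ℂ} {u : EntireGrowth n}
    (hu : u ∈ growthLE n 0)
    (hcomm : (fun t : ℝ => pairing (1 + t ^ 4) (diffOp p (mulOp p u) - mulOp p (diffOp p u)) u)
      =O[𝓝[>] 0] fun t => t ^ (0 : ℤ)) :
    ∀ q ∈ derivSpan p, mulOp q u ∈ growthLE n 0 := by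
  have hD := diffOp_mem_growthLE_zero hu hcomm
  have hT := polyAction_mulAt u
  have hclosed := MvPolynomial.pderivClosed_derivSpan p
  refine hT.mem_zero_of_improve (by simpa [mulAt] using hu) p fun a ha hyp => ?_
  intro q hq
  have hdiff : ∀ r ∈ derivSpan p, ∀ r' ∈ derivSpan p,
      (fun t : ℝ => pairing (1 + t ^ 4) (diffAt u (dilate ((1 + t ^ 4)⁻¹ : ℝ) r)) (diffAt u r'))
        =O[𝓝[>] 0] fun t => t ^ (0 : ℤ) := by
    intro r hr r' hr'
    refine isBigO_of_sub ((isBigO_pairing_dilate_sub_left_of_mem (polyAction_diffAt u)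
      isBigO_inv_scale hclosed hD (hD r' hr') hr).trans (isBigO_zpow_of_le (by norm_num))) ?_
    exact isBigO_pairing (a := 0) (b := 0) (hD r hr) (hD r' hr')
  have hmain : (fun t : ℝ => pairing (1 + t ^ 4) (mulAt u (dilate (1 + t ^ 4 : ℝ) q)) (mulAt u q))
      =O[𝓝[>] 0] fun t => t ^ (0 : ℤ) := by
    refine ((hdiff q hq q hq).add (IsBigO.fun_sum (s := taylorSupp q) fun α _ =>
      hdiff _ (hclosed.iterPDeriv_mem hq α) _ (hclosed.taylorCoeff_mem hq α))).congr' ?_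
        EventuallyEq.rfl
    filter_upwards [eventually_pos] with t ht
    have hs := one_lt_scale ht
    change _ = pairing (1 + t ^ 4) (mulOp (dilate (1 + t ^ 4 : ℝ) q) u) (mulOp q u)
    rw [← pairing_diffOp_right hs, commutator_apply, pairing_add_right hs, pairing_sum_right hs,
      pairing_mulOp_right hs]
    simp_rw [pairing_mulOp_right hs]
    rfl
  have herr := isBigO_pairing_dilate_sub_left_of_mem hT isBigO_scale hclosed hyp (hyp q hq) hq
  rw [show a + a + 2 = 2 * (a + 1) by ring] at herr
  refine mem_growthLE_of_sq (IsBigO.trans (IsBigO.of_bound 1 (Eventually.of_forall fun t => ?_))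
    ((hmain.trans (isBigO_zpow_of_le (by linarith))).sub herr))
  rw [sub_sub_cancel, pairing_self_eq, norm_real, one_mul]

end EntireGrowth

namespace EntireGrowth

open Asymptotics Topology
open MvPolynomial (X C pderiv taylorSupp taylorCoeff iterPDeriv dilate derivSpan mulDegLE
  PDerivClosed indexFactorial)

variable {n : ℕ}

lemma isBigO_pairing_mulOp_dilate_sub {p : MvPolynomial (Fin n) ℂ} {v f : EntireGrowth n}
    (hv : ∀ q ∈ derivSpan p, mulOp q v ∈ growthLE n 0) {b : ℤ} (hf : f ∈ growthLE n b) :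
    (fun t : ℝ => pairing (1 + t ^ 4) f (mulOp (dilate (1 + t ^ 4 : ℝ) p) v)
      - pairing (1 + t ^ 4) f (mulOp p v)) =O[𝓝[>] 0] fun t => t ^ (b + 2) := by
  have hT := polyAction_mulAt v
  refine isBigO_pairing_dilate_sub hT isBigO_scale f p b fun β hβ => ?_
  have := isBigO_pairing hf (hT.monomial_mul_mem hv β
    (MvPolynomial.taylorCoeff_mem_derivSpan p (MvPolynomial.ne_zero_of_mem_taylorSupp hβ)))
  rwa [show b + (0 - 2 * (β.degree : ℤ)) = b - 2 * β.degree by ring] at this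

lemma isBigO_pairing_mulOp_diffOp {p q : MvPolynomial (Fin n) ℂ} {u v : EntireGrowth n}
    (hu : ∀ r ∈ derivSpan q, mulOp r u ∈ growthLE n 0)
    (hv : ∀ r ∈ derivSpan p, mulOp r v ∈ growthLE n 0) {a : ℤ} (ha : a ≤ 0)
    (hm : mulOp p v ∈ growthLE n a) {b : ℕ} {R : MvPolynomial (Fin n) ℂ}
    (hR : R ∈ mulDegLE (derivSpan q) b) :
    (fun t : ℝ => pairing (1 + t ^ 4) (mulOp R (diffOp p u)) v)
      =O[𝓝[>] 0] fun t => t ^ (a - 2 * b) := by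
  have hRu : ∀ r ∈ mulDegLE (derivSpan q) b, mulOp r u ∈ growthLE n (0 - 2 * b) :=
    (polyAction_mulAt u).mem_of_mulDegLE hu b
  have hclosed := (MvPolynomial.pderivClosed_derivSpan q).mulDegLE b
  have hclosed' := MvPolynomial.pderivClosed_derivSpan p
  have hlead : (fun t : ℝ => pairing (1 + t ^ 4) (mulOp R u) (mulOp (dilate (1 + t ^ 4 : ℝ) p) v))
      =O[𝓝[>] 0] fun t => t ^ (a - 2 * b) := by
    refine isBigO_of_sub ((isBigO_pairing_mulOp_dilate_sub hv (hRu R hR)).trans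
      (isBigO_zpow_of_le (by linarith))) ?_
    exact (isBigO_pairing (hRu R hR) hm).trans (isBigO_zpow_of_le (by linarith))
  have hrest : ∀ γ ∈ taylorSupp p, (fun t : ℝ => (-1 : ℂ) ^ γ.degree *
      pairing (1 + t ^ 4) (mulOp (iterPDeriv γ R) u)
        (mulOp (dilate (1 + t ^ 4 : ℝ) (taylorCoeff γ p)) v))
      =O[𝓝[>] 0] fun t => t ^ (a - 2 * b) := by
    intro γ hγ
    have hγp := MvPolynomial.taylorCoeff_mem_derivSpan p
      (MvPolynomial.ne_zero_of_mem_taylorSupp hγ)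
    have hγR := hRu _ (hclosed.iterPDeriv_mem hR γ)
    refine IsBigO.const_mul_left (isBigO_of_sub ((isBigO_pairing_dilate_sub_of_mem
      (polyAction_mulAt v) isBigO_scale hclosed' hv hγR hγp).trans
        (isBigO_zpow_of_le (by linarith))) ?_) _
    exact (isBigO_pairing hγR (hv _ hγp)).trans (isBigO_zpow_of_le (by linarith))
  refine (hlead.add (IsBigO.fun_sum hrest)).congr' ?_ EventuallyEq.rfl
  filter_upwards [eventually_pos] with t ht
  have hs := one_lt_scale ht
  rw [commutator_apply', pairing_add_left hs, pairing_sum_left hs, pairing_diffOp hs]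
  simp_rw [pairing_smul_left, pairing_diffOp hs]

lemma isBigO_pairing_diffOp_diffOp {p q : MvPolynomial (Fin n) ℂ} {u v : EntireGrowth n}
    (hu : ∀ r ∈ derivSpan q, mulOp r u ∈ growthLE n 0)
    (hv : ∀ r ∈ derivSpan p, mulOp r v ∈ growthLE n 0) {a : ℤ} (ha : a ≤ 0)
    (hm : mulOp p v ∈ growthLE n a) {b : ℕ} {Q : MvPolynomial (Fin n) ℂ}
    (hQ : Q ∈ mulDegLE (derivSpan q) b) :
    (fun t : ℝ => pairing (1 + t ^ 4) (diffOp p u) (diffOp Q v))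
      =O[𝓝[>] 0] fun t => t ^ (a - 2 * b) := by
  have hclosed := (MvPolynomial.pderivClosed_derivSpan q).mulDegLE b
  have h : (fun t : ℝ => pairing (1 + t ^ 4) (mulAt (diffOp p u) (dilate (1 + t ^ 4 : ℝ) Q)) v)
      =O[𝓝[>] 0] fun t => t ^ (a - 2 * b) := by
    refine isBigO_of_sub ((isBigO_pairing_dilate_sub_left (polyAction_mulAt (diffOp p u))
      isBigO_scale v Q (a - 2 * b) fun β _ => ?_).trans (isBigO_zpow_of_le (by linarith)))
      (isBigO_pairing_mulOp_diffOp hu hv ha hm hQ)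
    have := isBigO_pairing_mulOp_diffOp hu hv ha hm
      (MvPolynomial.monomial_mul_mem_mulDegLE (hclosed.taylorCoeff_mem hQ β) β)
    rwa [show a - 2 * ((b + β.degree : ℕ) : ℤ) = a - 2 * b - 2 * β.degree by push_cast; ring]
      at this
  refine h.congr' ?_ EventuallyEq.rfl
  filter_upwards [eventually_pos] with t ht
  rw [pairing_diffOp_right (one_lt_scale ht)]
  rfl

lemma isBigO_pairing_commutator_sub {p q : MvPolynomial (Fin n) ℂ} {u v : EntireGrowth n}
    (hu : ∀ r ∈ derivSpan q, mulOp r u ∈ growthLE n 0)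
    (hv : ∀ r ∈ derivSpan p, mulOp r v ∈ growthLE n 0) {a : ℤ} (ha : a ≤ 0)
    (hmu : mulOp q u ∈ growthLE n a) (hmv : mulOp p v ∈ growthLE n a) :
    (fun t : ℝ => pairing (1 + t ^ 4) (diffOp p (mulOp q u) - mulOp q (diffOp p u)) v
      - (pairing (1 + t ^ 4) (mulOp q u) (mulOp p v)
        - pairing (1 + t ^ 4) (diffOp p u) (diffOp q v)))
      =O[𝓝[>] 0] fun t => t ^ (a + 2) := by
  have h1 := isBigO_pairing_mulOp_dilate_sub hv hmu
  have h2 := isBigO_pairing_dilate_sub (polyAction_diffAt v) isBigO_inv_scale (diffOp p u) q a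
    fun β hβ => by
      have := isBigO_pairing_diffOp_diffOp hu hv ha hmv
        (MvPolynomial.monomial_mul_mem_mulDegLE (V := derivSpan q) (b := 0)
          (MvPolynomial.taylorCoeff_mem_derivSpan q
            (MvPolynomial.ne_zero_of_mem_taylorSupp hβ)) β)
      rwa [zero_add] at this
  refine (h1.sub h2).congr' ?_ EventuallyEq.rfl
  filter_upwards [eventually_pos] with t ht
  have hs := one_lt_scale ht
  rw [pairing_sub_left hs, pairing_diffOp hs p (mulOp q u) v, pairing_mulOp hs q (diffOp p u) v]
  simp only [diffAt, AddMonoidHom.mk'_apply]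
  ring

lemma gaussNorm_sub_sq {s : ℝ} (hs : 1 < s) (f g : EntireGrowth n) :
    gaussNorm s (f - g) ^ 2
      = gaussNorm s f ^ 2 + gaussNorm s g ^ 2 - 2 * (pairing s f g).re := by
  have h : (pairing s g f).re = (pairing s f g).re := by rw [← pairing_conj, conj_re]
  rw [gaussNorm_sq, gaussNorm_sq, gaussNorm_sq, pairing_sub_left hs, pairing_sub_right hs,
    pairing_sub_right hs]
  simp only [sub_re, h]
  ring

lemma isBigO_gaussNorm_sq {f : EntireGrowth n} {a : ℤ} (hf : f ∈ growthLE n a) :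
    (fun t : ℝ => gaussNorm (1 + t ^ 4) f ^ 2) =O[𝓝[>] 0] fun t => t ^ (2 * a) := by
  have := isBigO_pairing hf hf
  rw [← two_mul] at this
  refine (this.norm_left.congr_left fun t => ?_)
  rw [pairing_self_eq, norm_real, Real.norm_of_nonneg (sq_nonneg _)]

/-- The asymptotic form of the basic identity: the quadratic form of the commutators `[p_k, p_j*]`
is at most `‖D*u‖² + ‖Du‖²` in `L²(e^{-(1+t⁴)|z|²})`, up to `O(t²)`. -/
lemma exists_commutator_sum_le (P : Fin n → MvPolynomial (Fin n) ℂ) (u : Fin n → EntireGrowth n)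
    (hu : ∀ j, u j ∈ growthLE n 0)
    (hF : ∑ j, mulOp (P j) (u j) ∈ growthLE n 0)
    (hG : ∀ j k, diffOp (P k) (u j) - diffOp (P j) (u k) ∈ growthLE n 0)
    (hcomm : ∀ j k, (fun t : ℝ => pairing (1 + t ^ 4)
      (diffOp (P k) (mulOp (P j) (u j)) - mulOp (P j) (diffOp (P k) (u j))) (u k))
        =O[𝓝[>] 0] fun t => t ^ (0 : ℤ)) :
    ∃ E : ℝ → ℝ, (E =O[𝓝[>] 0] fun t => t ^ (2 : ℤ)) ∧ ∀ t > 0,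
      ∑ j, ∑ k, (pairing (1 + t ^ 4) (diffOp (P k) (mulOp (P j) (u j))
          - mulOp (P j) (diffOp (P k) (u j))) (u k)).re
        ≤ gaussNorm (1 + t ^ 4) (∑ j, mulOp (P j) (u j)) ^ 2
          + 1 / 2 * ∑ j, ∑ k,
            gaussNorm (1 + t ^ 4) (diffOp (P k) (u j) - diffOp (P j) (u k)) ^ 2 + E t := by
  have hmul : ∀ j, ∀ q ∈ derivSpan (P j), mulOp q (u j) ∈ growthLE n 0 := fun j =>
    mulOp_mem_growthLE_zero (hu j) (hcomm j j)
  set c : Fin n → Fin n → ℝ → ℝ := fun j k t => (pairing (1 + t ^ 4)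
    (diffOp (P k) (mulOp (P j) (u j)) - mulOp (P j) (diffOp (P k) (u j))) (u k)).re with hc
  set E : Fin n → Fin n → ℝ → ℝ := fun j k t => (pairing (1 + t ^ 4)
      (diffOp (P k) (mulOp (P j) (u j)) - mulOp (P j) (diffOp (P k) (u j))) (u k)
      - (pairing (1 + t ^ 4) (mulOp (P j) (u j)) (mulOp (P k) (u k))
        - pairing (1 + t ^ 4) (diffOp (P k) (u j)) (diffOp (P j) (u k)))).re with hE
  set x : Fin n → Fin n → ℝ → ℝ := fun j k t =>
    gaussNorm (1 + t ^ 4) (diffOp (P k) (u j)) ^ 2 with hx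
  set g : Fin n → Fin n → ℝ → ℝ := fun j k t =>
    gaussNorm (1 + t ^ 4) (diffOp (P k) (u j) - diffOp (P j) (u k)) ^ 2 with hg
  set F : ℝ → ℝ := fun t => gaussNorm (1 + t ^ 4) (∑ j, mulOp (P j) (u j)) ^ 2 with hFdef
  have hre : ∀ {f : ℝ → ℂ} {k : ℝ → ℝ}, f =O[𝓝[>] 0] k → (fun t => (f t).re) =O[𝓝[>] 0] k :=
    fun h => IsBigO.trans (IsBigO.of_bound 1 (Eventually.of_forall fun t => by
      rw [one_mul]; exact abs_re_le_norm _)) h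
  have hEO : ∀ a : ℤ, a ≤ 0 → (∀ j, mulOp (P j) (u j) ∈ growthLE n a) →
      ∀ j k, E j k =O[𝓝[>] 0] fun t => t ^ (a + 2) := fun a ha hyp j k =>
    hre (isBigO_pairing_commutator_sub (hmul j) (hmul k) ha (hyp j) (hyp k))
  have hid : ∀ t > 0, ∑ j, ∑ k, c j k t
      = F t + 1 / 2 * ∑ j, ∑ k, g j k t - ∑ j, ∑ k, x j k t + ∑ j, ∑ k, E j k t := by
    intro t ht
    have hs := one_lt_scale ht
    have h1 : ∀ j k, c j k t = (pairing (1 + t ^ 4) (mulOp (P j) (u j)) (mulOp (P k) (u k))).re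
        + 1 / 2 * g j k t - 1 / 2 * x j k t - 1 / 2 * x k j t + E j k t := by
      intro j k
      have := gaussNorm_sub_sq hs (diffOp (P k) (u j)) (diffOp (P j) (u k))
      simp only [hc, hE, hx, hg, this, sub_re]
      ring
    have h2 : F t = ∑ j, ∑ k, (pairing (1 + t ^ 4) (mulOp (P j) (u j)) (mulOp (P k) (u k))).re := by
      simp only [hFdef]
      rw [gaussNorm_sq, pairing_sum_left hs, re_sum]
      simp_rw [pairing_sum_right hs, re_sum]
    have h3 : ∑ j, ∑ k, x k j t = ∑ j, ∑ k, x j k t := Finset.sum_comm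
    simp_rw [h1, Finset.sum_add_distrib, Finset.sum_sub_distrib, Finset.sum_add_distrib,
      ← Finset.mul_sum, h3]
    rw [h2]
    ring
  have hxnn : ∀ t, 0 ≤ ∑ j, ∑ k, x j k t := fun t =>
    Finset.sum_nonneg fun j _ => Finset.sum_nonneg fun k _ => sq_nonneg _
  have himprove : ∀ a : ℤ, a ≤ -1 → (∀ j, mulOp (P j) (u j) ∈ growthLE n a) →
      ∀ j, mulOp (P j) (u j) ∈ growthLE n (a + 1) := by
    intro a ha hyp j
    have hEa := hEO a (by linarith) hyp
    have hbound : (fun t => F t + 1 / 2 * ∑ j, ∑ k, g j k t - ∑ j, ∑ k, c j k t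
        + ∑ j, ∑ k, E j k t + c j j t - E j j t) =O[𝓝[>] 0] fun t : ℝ => t ^ (2 * (a + 1)) := by
      have hE' : ∀ j k, E j k =O[𝓝[>] 0] fun t : ℝ => t ^ (2 * (a + 1)) := fun j k =>
        (hEa j k).trans (isBigO_zpow_of_le (by linarith))
      have hc' : ∀ j k, c j k =O[𝓝[>] 0] fun t : ℝ => t ^ (2 * (a + 1)) := fun j k =>
        (hre (hcomm j k)).trans (isBigO_zpow_of_le (by linarith))
      have hg' : ∀ j k, g j k =O[𝓝[>] 0] fun t : ℝ => t ^ (2 * (a + 1)) := fun j k =>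
        (isBigO_gaussNorm_sq (hG j k)).trans (isBigO_zpow_of_le (by linarith))
      have hF' : F =O[𝓝[>] 0] fun t : ℝ => t ^ (2 * (a + 1)) :=
        (isBigO_gaussNorm_sq hF).trans (isBigO_zpow_of_le (by linarith))
      exact ((((hF'.add ((IsBigO.fun_sum fun j _ => IsBigO.fun_sum fun k _ =>
        hg' j k).const_mul_left _)).sub (IsBigO.fun_sum fun j _ => IsBigO.fun_sum fun k _ =>
        hc' j k)).add (IsBigO.fun_sum fun j _ => IsBigO.fun_sum fun k _ =>
        hE' j k)).add (hc' j j)).sub (hE' j j)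
    refine mem_growthLE_of_sq (IsBigO.trans (IsBigO.of_bound 1 ?_) hbound)
    filter_upwards [eventually_pos] with t ht
    rw [one_mul, Real.norm_of_nonneg (sq_nonneg _)]
    refine le_trans ?_ (le_abs_self _)
    have h1 : x j j t ≤ ∑ j, ∑ k, x j k t :=
      (Finset.single_le_sum (f := fun k => x j k t) (fun k _ => sq_nonneg _)
        (Finset.mem_univ j)).trans (Finset.single_le_sum (f := fun j => ∑ k, x j k t)
          (fun j _ => Finset.sum_nonneg fun k _ => sq_nonneg _) (Finset.mem_univ j))
    have h2 : gaussNorm (1 + t ^ 4) (mulOp (P j) (u j)) ^ 2 = x j j t + c j j t - E j j t := by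
      simp only [hc, hE, hx, sub_re, gaussNorm_sq]
      ring
    have h3 := hid t ht
    rw [h2]
    linarith
  have hzero : ∀ j, mulOp (P j) (u j) ∈ growthLE n 0 := by
    have hex : ∀ j, ∃ b : ℕ, mulOp (P j) (u j) ∈ growthLE n (-b) := fun j =>
      (polyAction_mulAt (u j)).exists_mem (by simpa [mulAt] using hu j) (P j)
    choose b hb using hex
    have hstart : ∀ j, mulOp (P j) (u j) ∈ growthLE n (-((Finset.univ.sup b : ℕ) : ℤ)) := by
      refine fun j => growthLE_mono ?_ (hb j)
      have := Finset.le_sup (f := b) (Finset.mem_univ j)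
      simp only [neg_le_neg_iff]
      exact_mod_cast this
    generalize Finset.univ.sup b = N at hstart
    induction N with
    | zero => simpa using hstart
    | succ N ih =>
      refine ih ?_
      have := himprove _ (by push_cast; linarith) hstart
      rwa [show -((N + 1 : ℕ) : ℤ) + 1 = -(N : ℤ) by push_cast; ring] at this
  refine ⟨fun t => ∑ j, ∑ k, E j k t, ?_, fun t ht => ?_⟩
  · refine IsBigO.fun_sum fun j _ => IsBigO.fun_sum fun k _ => ?_
    have := hEO 0 le_rfl hzero j k
    rwa [zero_add] at this
  · have h1 := hid t ht
    have h2 := hxnn t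
    linarith

end EntireGrowth

namespace EntireGrowth

open Asymptotics Topology

variable {n : ℕ}

lemma norm_pairing_integrand_le {s : ℝ} (hs : 1 < s) (f g : EntireGrowth n) (z : Cn n) :
    ‖(f : Cn n → ℂ) z * (starRingEnd ℂ) ((g : Cn n → ℂ) z) * gaussWt s z‖
      ≤ ‖(f : Cn n → ℂ) z * (starRingEnd ℂ) ((g : Cn n → ℂ) z) * fWt z‖ := by
  rw [norm_mul, norm_mul _ (fWt z : ℂ), ← gaussWt_one, norm_real, norm_real,
    Real.norm_of_nonneg (gaussWt_pos _ _).le, Real.norm_of_nonneg (gaussWt_pos _ _).le]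
  exact mul_le_mul_of_nonneg_left (gaussWt_anti hs.le z) (norm_nonneg _)

lemma tendsto_pairing {f g : EntireGrowth n}
    (hfg : Integrable fun z : Cn n =>
      (f : Cn n → ℂ) z * (starRingEnd ℂ) ((g : Cn n → ℂ) z) * fWt z) :
    Tendsto (fun t : ℝ => pairing (1 + t ^ 4) f g) (𝓝[>] 0)
      (𝓝 (fInner (f : Cn n → ℂ) (g : Cn n → ℂ))) := by
  refine tendsto_integral_filter_of_dominated_convergence _ ?_ ?_ hfg.norm ?_
  · filter_upwards [eventually_pos] with t ht
    exact (integrable_pairing (one_lt_scale ht) f g).aestronglyMeasurable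
  · filter_upwards [eventually_pos] with t ht
    exact Eventually.of_forall (norm_pairing_integrand_le (one_lt_scale ht) f g)
  · refine Eventually.of_forall fun z => Tendsto.const_mul _ ?_
    have hcont : Continuous fun t : ℝ => (gaussWt (1 + t ^ 4) z : ℂ) := by
      unfold gaussWt; fun_prop
    have := hcont.tendsto 0
    rw [show (1 : ℝ) + 0 ^ 4 = 1 by norm_num, gaussWt_one] at this
    exact this.mono_left nhdsWithin_le_nhds

lemma re_fInner_commutator_sum_le (P : Fin n → MvPolynomial (Fin n) ℂ)
    (u : Fin n → EntireGrowth n) (hu : ∀ j, MemF (u j : Cn n → ℂ))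
    (hF : MemF ((∑ j, mulOp (P j) (u j) : EntireGrowth n) : Cn n → ℂ))
    (hG : ∀ j k, MemF ((diffOp (P k) (u j) - diffOp (P j) (u k) : EntireGrowth n) : Cn n → ℂ))
    (hintegrable : ∀ j k, Integrable fun z : Cn n =>
      ((diffOp (P k) (mulOp (P j) (u j)) - mulOp (P j) (diffOp (P k) (u j)) :
        EntireGrowth n) : Cn n → ℂ) z * (starRingEnd ℂ) ((u k : Cn n → ℂ) z) * fWt z) :
    ∑ j, ∑ k, (fInner ((diffOp (P k) (mulOp (P j) (u j)) - mulOp (P j) (diffOp (P k) (u j)) :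
        EntireGrowth n) : Cn n → ℂ) (u k : Cn n → ℂ)).re
      ≤ fNormSq ((∑ j, mulOp (P j) (u j) : EntireGrowth n) : Cn n → ℂ)
        + 1 / 2 * ∑ j, ∑ k,
          fNormSq ((diffOp (P k) (u j) - diffOp (P j) (u k) : EntireGrowth n) : Cn n → ℂ) := by
  obtain ⟨E, hE, hle⟩ := exists_commutator_sum_le P u
    (fun j => mem_growthLE_zero_of_memF (hu j)) (mem_growthLE_zero_of_memF hF)
    (fun j k => mem_growthLE_zero_of_memF (hG j k)) fun j k => by
      simpa only [zpow_zero] using (tendsto_pairing (hintegrable j k)).isBigO_one ℝ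
  have hE0 : Tendsto E (𝓝[>] 0) (𝓝 0) := by
    refine hE.trans_tendsto ?_
    have hcont : Continuous fun t : ℝ => t ^ (2 : ℤ) := by
      simpa only [zpow_ofNat] using continuous_pow 2
    have := hcont.tendsto 0
    rw [show (0 : ℝ) ^ (2 : ℤ) = 0 by norm_num] at this
    exact this.mono_left nhdsWithin_le_nhds
  have hlim : Tendsto (fun t : ℝ => ∑ j, ∑ k, (pairing (1 + t ^ 4)
      (diffOp (P k) (mulOp (P j) (u j)) - mulOp (P j) (diffOp (P k) (u j))) (u k)).re - E t)
      (𝓝[>] 0) (𝓝 (∑ j, ∑ k, (fInner ((diffOp (P k) (mulOp (P j) (u j))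
        - mulOp (P j) (diffOp (P k) (u j)) : EntireGrowth n) : Cn n → ℂ)
          (u k : Cn n → ℂ)).re - 0)) :=
    (tendsto_finsetSum _ fun j _ => tendsto_finsetSum _ fun k _ =>
      (continuous_re.tendsto _).comp (tendsto_pairing (hintegrable j k))).sub hE0
  rw [sub_zero] at hlim
  refine le_of_tendsto hlim ?_
  filter_upwards [eventually_pos] with t ht
  have hs := one_lt_scale ht
  have h1 := hle t ht
  have h2 := gaussNorm_sq_le_fNormSq hs hF
  have h3 := Finset.sum_le_sum fun j (_ : j ∈ Finset.univ) =>
    Finset.sum_le_sum fun k (_ : k ∈ Finset.univ) => gaussNorm_sq_le_fNormSq hs (hG j k)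
  linarith

end EntireGrowth

lemma half_sum_sum_eq_sum_Ioi {n : ℕ} (g : Fin n → Fin n → ℝ) (hsymm : ∀ j k, g j k = g k j)
    (hdiag : ∀ j, g j j = 0) :
    1 / 2 * ∑ j, ∑ k, g j k = ∑ j, ∑ k ∈ Finset.Ioi j, g j k := by
  have hsplit : ∀ j, ∑ k, g j k = ∑ k ∈ Finset.Iio j, g j k + ∑ k ∈ Finset.Ioi j, g j k := by
    intro j
    rw [← Finset.sum_union (Finset.disjoint_left.2 fun k h1 h2 =>
      lt_asymm (Finset.mem_Iio.1 h1) (Finset.mem_Ioi.1 h2))]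
    refine (Finset.sum_subset (Finset.subset_univ _) fun k _ hk => ?_).symm
    have : k = j := by
      simp only [Finset.mem_union, Finset.mem_Iio, Finset.mem_Ioi, not_or, not_lt] at hk
      exact le_antisymm hk.2 hk.1
    rw [this, hdiag]
  have hswap : ∑ j, ∑ k ∈ Finset.Iio j, g j k = ∑ j, ∑ k ∈ Finset.Ioi j, g j k := by
    rw [Finset.sum_comm' (t' := Finset.univ) (s' := fun k => Finset.Ioi k) (by simp)]
    exact Finset.sum_congr rfl fun j _ => Finset.sum_congr rfl fun k _ => hsymm k j
  simp_rw [hsplit, Finset.sum_add_distrib, hswap]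
  ring

open EntireGrowth in
lemma sum_re_fInner_commD_le {n : ℕ} (P : Fin n → MvPolynomial (Fin n) ℂ)
    (u : Fin n → Cn n → ℂ) (hu : ∀ j, MemF (u j))
    (hG : ∀ j k, MemF (fun z => polyD (P k) (u j) z - polyD (P j) (u k) z))
    (hF : MemF (fun z => ∑ j, pMul (P j) (u j) z))
    (hintegrable : ∀ j k, Integrable (fun z : Cn n =>
      commD (P k) (P j) (u j) z * (starRingEnd ℂ) (u k z) * fWt z)) :
    ∑ j, ∑ k, (fInner (commD (P k) (P j) (u j)) (u k)).re
      ≤ (∑ j, ∑ k ∈ Finset.Ioi j,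
          fNormSq (fun z => polyD (P k) (u j) z - polyD (P j) (u k) z))
        + fNormSq (fun z => ∑ j, pMul (P j) (u j) z) := by
  set U : Fin n → EntireGrowth n := fun j => ⟨u j, (hu j).mem_entireGrowth⟩ with hU
  have hcoeG : ∀ j k, ((diffOp (P k) (U j) - diffOp (P j) (U k) : EntireGrowth n) : Cn n → ℂ)
      = fun z => polyD (P k) (u j) z - polyD (P j) (u k) z := by
    intro j k
    rw [Submodule.coe_sub, coe_diffOp, coe_diffOp]
    rfl
  have hcoeF : ((∑ j, mulOp (P j) (U j) : EntireGrowth n) : Cn n → ℂ)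
      = fun z => ∑ j, pMul (P j) (u j) z := by
    rw [Submodule.coe_sum]
    simp_rw [coe_mulOp]
    funext z
    rw [Finset.sum_apply]
  have hcoeK : ∀ j k, ((diffOp (P k) (mulOp (P j) (U j)) - mulOp (P j) (diffOp (P k) (U j)) :
      EntireGrowth n) : Cn n → ℂ) = commD (P k) (P j) (u j) := by
    intro j k
    rw [Submodule.coe_sub, coe_diffOp, coe_mulOp, coe_mulOp, coe_diffOp]
    rfl
  have hmain := re_fInner_commutator_sum_le P U hu (by rwa [hcoeF])
    (fun j k => by rw [hcoeG]; exact hG j k) (fun j k => by rw [hcoeK]; exact hintegrable j k)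
  simp_rw [hcoeK, hcoeG, hcoeF] at hmain
  rw [half_sum_sum_eq_sum_Ioi
    (fun j k => fNormSq (fun z => polyD (P k) (u j) z - polyD (P j) (u k) z))
    (fun j k => by simp only [fNormSq, norm_sub_rev]) (fun j => by simp [fNormSq])] at hmain
  rw [add_comm]
  exact hmain

/-- For `D u = Σ_j p_j(u) dz_j` with adjoint `D* v = Σ_j p_j^* v_j`:
if `‖u‖² ≤ C Σ_{j,k} ([p_k, p_j^*] u_j, u_k)` for all `(1,0)`-forms
`u ∈ dom D ∩ dom D*`, then `‖u‖² ≤ C (‖Du‖² + ‖D*u‖²)` for all such `u`. -/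
theorem stmt17 {n : ℕ}
    (P : Fin n → MvPolynomial (Fin n) ℂ) (C : ℝ) (hC : 0 < C)
    (hcomm : ∀ u : Fin n → Cn n → ℂ,
      (∀ j, MemF (u j)) →
      (∀ j k, MemF (fun z => polyD (P k) (u j) z - polyD (P j) (u k) z)) →
      MemF (fun z => ∑ j, pMul (P j) (u j) z) →
      (∀ j k, Integrable (fun z : Cn n =>
        commD (P k) (P j) (u j) z * (starRingEnd ℂ) (u k z) * fWt z)) →
      (∑ j, fNormSq (u j))
        ≤ C * (∑ j, ∑ k, (fInner (commD (P k) (P j) (u j)) (u k)).re)) :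
    ∀ u : Fin n → Cn n → ℂ,
      (∀ j, MemF (u j)) →
      (∀ j k, MemF (fun z => polyD (P k) (u j) z - polyD (P j) (u k) z)) →
      MemF (fun z => ∑ j, pMul (P j) (u j) z) →
      (∀ j k, Integrable (fun z : Cn n =>
        commD (P k) (P j) (u j) z * (starRingEnd ℂ) (u k z) * fWt z)) →
      (∑ j, fNormSq (u j))
        ≤ C * ((∑ j, ∑ k ∈ Finset.Ioi j,
              fNormSq (fun z => polyD (P k) (u j) z - polyD (P j) (u k) z))
            + fNormSq (fun z => ∑ j, pMul (P j) (u j) z)) := by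
  intro u hu hG hF hintegrable
  exact (hcomm u hu hG hF hintegrable).trans
    (mul_le_mul_of_nonneg_left (sum_re_fInner_commD_le P u hu hG hF hintegrable) hC.le)
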